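/- arXiv:1712.01009 — 2 statements merged into one kernel-verified Lean document; each statement's English description precedes it below -/
import Mathlib

section
/- Let μ ∈ P be an integral weight, and let B₀(μ) be the connected component of B(μ) containing π_μ. Let π ∈ B₀(μ), written as π = x̃_{i_p} ⋯ x̃_{i_1}π_μ where each x̃_{i_q} is either ẽ_{i_q} or f̃_{i_q}, and set π_q := x̃_{i_q} ⋯ x̃_{i_1}π_μ for 0 ≤ q ≤ p. Then there exists m ∈ ℤ_{≥1} such that for every 0 ≤ q ≤ p there are Weyl group elements w_{q,1}, w_{q,2}, …, w_{q,m} ∈ W with Σ_m(π_q) = π_{w_{q,1}μ} ⊗ π_{w_{q,2}μ} ⊗ ⋯ ⊗ π_{w_{q,m}μ}, i.e., Σ_m(π_q) is a tensor product of m straight-line (extremal) LS paths. -/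
open scoped Classical
noncomputable section

namespace LSPaper

/-- The clamp of a real number to the interval `[0,1]`; paths `[0,1] → V` are
encoded as functions `ℝ → V` that factor through this clamp. -/
def clamp01 (t : ℝ) : ℝ := max 0 (min 1 t)

variable {V : Type*} [AddCommGroup V] [Module ℝ V]

/-- The straight-line path `π_ν(t) = t ν` (clamped outside `[0,1]`). -/
def straight (ν : V) : ℝ → V := fun t => clamp01 t • ν

/-- The dilation `(mπ)(t) = m • π(t)`. -/
def dilate (m : ℕ) (f : ℝ → V) : ℝ → V := fun t => (m : ℝ) • f t

/-- The concatenation `π_1 * ⋯ * π_m` of a list of paths: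
`(π_1 * ⋯ * π_m)(t) = Σ_{l<k} π_l(1) + π_k(mt - k + 1)` for
`(k-1)/m ≤ t ≤ k/m`. -/
def concatList (l : List (ℝ → V)) : ℝ → V := fun t =>
  let m := l.length
  let k : ℕ := max 1 (min m (⌈(m : ℝ) * t⌉.toNat))
  (((l.take (k - 1)).map fun f => f 1).sum) +
    (l.getD (k - 1) 0) ((m : ℝ) * t - ((k : ℝ) - 1))

/-- Subdivision of a path into `m` pieces:
`π_k(t) = π(t/m + (k-1)/m) - π((k-1)/m)` (here `k` runs over `0, …, m-1`). -/
def subdiv (m : ℕ) (f : ℝ → V) : List (ℝ → V) :=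
  List.ofFn fun k : Fin m => fun t : ℝ =>
    f ((clamp01 t + (k : ℝ)) / m) - f ((k : ℝ) / m)

/-- The map `Σ_m : B(μ) → B(μ)^{⊗m}` (tensor factors encoded as a list):
dilate by `m`, then subdivide into `m` pieces. -/
def SigmaMap (m : ℕ) (f : ℝ → V) : List (ℝ → V) := subdiv m (dilate m f)

/-- The weight of a tensor product (encoded as a list of paths): the sum of
the weights of the factors. -/
def tensWt (l : List (ℝ → V)) : V := (l.map fun f => f 1).sum

/-- A symmetrizable generalized Cartan matrix together with a realization:
an integral weight lattice `P` inside a real vector space `V`, linearly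
independent simple roots `α i ∈ P` and simple coroots (as linear functionals)
with `⟨α j, α i∨⟩ = a i j`, taking integer values on `P`. -/
structure KacMoodyData (I : Type*) (V : Type*) [Fintype I] [DecidableEq I]
    [AddCommGroup V] [Module ℝ V] where
  a : I → I → ℤ
  d : I → ℤ
  P : AddSubgroup V
  α : I → V
  coroot : I → V →ₗ[ℝ] ℝ
  diag : ∀ i, a i i = 2
  offDiag : ∀ i j, i ≠ j → a i j ≤ 0
  zeroIff : ∀ i j, a i j = 0 ↔ a j i = 0
  dPos : ∀ i, 0 < d i
  symmetrizable : ∀ i j, d i * a i j = d j * a j i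
  cartanPairing : ∀ i j, coroot i (α j) = (a i j : ℝ)
  rootsIndep : LinearIndependent ℝ α
  corootsIndep : LinearIndependent ℝ coroot
  rootMem : ∀ i, α i ∈ P
  pairingInt : ∀ i, ∀ v ∈ P, ∃ n : ℤ, coroot i v = (n : ℝ)
  latticeFree : ∃ n : ℕ, Nonempty (P ≃+ (Fin n → ℤ))

namespace KacMoodyData

variable {I : Type*} [Fintype I] [DecidableEq I]
variable (K : KacMoodyData I V)

/-- The simple reflection `r_i(x) = x - ⟨x, α_i∨⟩ α_i` as a linear map. -/
def reflMap (i : I) : V →ₗ[ℝ] V := LinearMap.id - (K.coroot i).smulRight (K.α i)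

lemma reflMap_invol (i : I) : Function.Involutive (K.reflMap i) := by
  intro x
  have h2 : K.coroot i (K.α i) = 2 := by
    have h := K.cartanPairing i i
    rw [K.diag i] at h
    simpa using h
  simp only [reflMap, LinearMap.sub_apply, LinearMap.id_apply, LinearMap.smulRight_apply,
    map_sub, map_smul, smul_eq_mul, h2]
  module

/-- The simple reflection `r_i` as a linear automorphism of `V`. -/
def refl (i : I) : V ≃ₗ[ℝ] V :=
  { K.reflMap i with
    invFun := K.reflMap i
    left_inv := K.reflMap_invol i
    right_inv := K.reflMap_invol i }

/-- The Weyl group `W`, generated by the simple reflections. -/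
def weylGroup : Subgroup (V ≃ₗ[ℝ] V) := Subgroup.closure (Set.range K.refl)

/-- The Weyl group orbit `W μ` of an integral weight. -/
def orbit (μ : V) : Set V := {ν | ∃ w ∈ K.weylGroup, ν = w μ}

/-- `Q_+ = Σ_i ℤ_{≥0} α_i`. -/
def Qplus : Set V := {v | ∃ c : I → ℕ, v = ∑ i, (c i : ℝ) • K.α i}

/-- One step of the order on a Weyl group orbit:  `ν' = r_β(ν)` for a positive
real root `β = w α_i ∈ Q_+` (with `β∨ = w α_i∨`, `r_β = w r_i w⁻¹`) such that
`⟨ν, β∨⟩ < 0`. -/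
def StepDown (ν ν' : V) : Prop :=
  ∃ w ∈ K.weylGroup, ∃ i : I, w (K.α i) ∈ K.Qplus ∧
    K.coroot i (w.symm ν) < 0 ∧ ν' = w (K.refl i (w.symm ν))

/-- There is a chain `ν = ξ_0, ξ_1, …, ξ_p = ν'` of steps down. -/
def chainLen (p : ℕ) (ν ν' : V) : Prop :=
  ∃ ξ : ℕ → V, ξ 0 = ν ∧ ξ p = ν' ∧ ∀ q < p, K.StepDown (ξ q) (ξ (q + 1))

/-- `dist(ν, ν')`: the maximal length of a chain from `ν` down to `ν'`. -/
def dist (ν ν' : V) : ℕ := sSup {p | K.chainLen p ν ν'}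

/-- A `σ`-chain for `(ν, ν')`: a sequence `ν = ξ_0 > ξ_1 > ⋯ > ξ_p = ν'` with
`dist(ξ_{q-1}, ξ_q) = 1` and `σ ⟨ξ_{q-1}, β_q∨⟩ ∈ ℤ_{<0}`, where `β_q` is the
positive real root with `ξ_q = r_{β_q} ξ_{q-1}`. -/
def SigmaChain (σ : ℚ) (ν ν' : V) : Prop :=
  ∃ p : ℕ, 0 < p ∧ ∃ ξ : ℕ → V, ξ 0 = ν ∧ ξ p = ν' ∧
    ∀ q < p, K.dist (ξ q) (ξ (q + 1)) = 1 ∧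
      ∃ w ∈ K.weylGroup, ∃ i : I, w (K.α i) ∈ K.Qplus ∧
        ξ (q + 1) = w (K.refl i (w.symm (ξ q))) ∧
        ∃ n : ℤ, n < 0 ∧ (σ : ℝ) * K.coroot i (w.symm (ξ q)) = (n : ℝ)

/-- The combinatorial datum of a Lakshmibai–Seshadri path of shape `μ`:
a strictly decreasing sequence `ν_1 > ν_2 > ⋯ > ν_s` in `W μ` together with
rationals `0 = σ_0 < σ_1 < ⋯ < σ_s = 1` admitting `σ_u`-chains (the `ν`'s are
indexed here by `Fin s`, i.e. `0, …, s-1`). -/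
structure LSData (K : KacMoodyData I V) (μ : V) where
  s : ℕ
  spos : 0 < s
  ν : Fin s → V
  τ : Fin (s + 1) → ℚ
  mem : ∀ u, ν u ∈ K.orbit μ
  strictDec : ∀ (u : ℕ) (h : u + 1 < s),
    Relation.TransGen K.StepDown (ν ⟨u, Nat.lt_of_succ_lt h⟩) (ν ⟨u + 1, h⟩)
  τ_zero : τ 0 = 0
  τ_last : τ (Fin.last s) = 1
  τ_mono : StrictMono τ
  chainCond : ∀ (u : ℕ) (h : u + 1 < s),
    K.SigmaChain (τ ⟨u + 1, Nat.lt_succ_of_lt h⟩) (ν ⟨u, Nat.lt_of_succ_lt h⟩) (ν ⟨u + 1, h⟩)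

/-- The piecewise-linear path `[0,1] → ℝ ⊗ P` associated with an LS datum:
`π(t) = Σ_{k<u} (σ_k - σ_{k-1}) ν_k + (t - σ_{u-1}) ν_u` for `σ_{u-1} ≤ t ≤ σ_u`,
encoded as the function `ℝ → V`, `t ↦ Σ_k (min t σ_{k+1} - min t σ_k) • ν_k`
(which is constant for `t ≤ 0` and `t ≥ 1`). -/
def LSData.path {K : KacMoodyData I V} {μ : V} (π : K.LSData μ) : ℝ → V := fun t =>
  ∑ k : Fin π.s,
    ((min t ((π.τ k.succ : ℚ) : ℝ)) - (min t ((π.τ k.castSucc : ℚ) : ℝ))) • π.ν k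

/-- `B(μ)`: the set of Lakshmibai–Seshadri paths of shape `μ`. -/
def B (μ : V) : Set (ℝ → V) := {f | ∃ π : K.LSData μ, f = π.path}

/-- `H_i^π(t) = ⟨π(t), α_i∨⟩`. -/
def H (i : I) (f : ℝ → V) : ℝ → ℝ := fun t => K.coroot i (f t)

/-- `m_i^π = min {H_i^π(t) : t ∈ [0,1]}`. -/
def mval (i : I) (f : ℝ → V) : ℝ := sInf (K.H i f '' Set.Icc 0 1)

/-- The raising root operator `ẽ_i` (the underlying path, before testing
whether it is defined): with `t_1 = min {t : H_i^π(t) = m_i^π}` and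
`t_0 = max {t ≤ t_1 : H_i^π(t) = m_i^π + 1}`, the new path is `π(t)` for
`t ≤ t_0`, `r_i(π(t) - π(t_0)) + π(t_0)` for `t_0 ≤ t ≤ t_1` and `π(t) + α_i`
for `t ≥ t_1`. -/
def eraw (i : I) (f : ℝ → V) : ℝ → V := fun t =>
  let m := K.mval i f
  let t1 := sInf {t | t ∈ Set.Icc (0 : ℝ) 1 ∧ K.H i f t = m}
  let t0 := sSup {t | t ∈ Set.Icc (0 : ℝ) t1 ∧ K.H i f t = m + 1}
  if t ≤ t0 then f t
  else if t ≤ t1 then K.refl i (f t - f t0) + f t0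
  else f t + K.α i

/-- The lowering root operator `f̃_i` (the underlying path): with
`t_0 = max {t : H_i^π(t) = m_i^π}` and `t_1 = min {t ≥ t_0 : H_i^π(t) = m_i^π + 1}`,
the new path is `π(t)` for `t ≤ t_0`, `r_i(π(t) - π(t_0)) + π(t_0)` for
`t_0 ≤ t ≤ t_1` and `π(t) - α_i` for `t ≥ t_1`. -/
def fraw (i : I) (f : ℝ → V) : ℝ → V := fun t =>
  let m := K.mval i f
  let t0 := sSup {t | t ∈ Set.Icc (0 : ℝ) 1 ∧ K.H i f t = m}
  let t1 := sInf {t | t ∈ Set.Icc t0 1 ∧ K.H i f t = m + 1}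
  if t ≤ t0 then f t
  else if t ≤ t1 then K.refl i (f t - f t0) + f t0
  else f t - K.α i

/-- The root operator `ẽ_i`, with value `none` (the formal element `0`) when
`m_i^π = 0`. -/
def eop (i : I) (f : ℝ → V) : Option (ℝ → V) :=
  if K.mval i f = 0 then none else some (K.eraw i f)

/-- The root operator `f̃_i`, with value `none` (the formal element `0`) when
`H_i^π(1) - m_i^π = 0`. -/
def fop (i : I) (f : ℝ → V) : Option (ℝ → V) :=
  if K.H i f 1 - K.mval i f = 0 then none else some (K.fraw i f)

/-- `ẽ_i^n π` (with `ẽ_i 0 = 0`). -/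
def eIter (i : I) (n : ℕ) (f : ℝ → V) : Option (ℝ → V) :=
  (fun o => o.bind (K.eop i))^[n] (some f)

/-- `f̃_i^n π` (with `f̃_i 0 = 0`). -/
def fIter (i : I) (n : ℕ) (f : ℝ → V) : Option (ℝ → V) :=
  (fun o => o.bind (K.fop i))^[n] (some f)

/-- `ε_i(π) = max {n ≥ 0 : ẽ_i^n π ≠ 0}`. -/
def epsilon (i : I) (f : ℝ → V) : ℕ := sSup {n | K.eIter i n f ≠ none}

/-- `φ_i(π) = max {n ≥ 0 : f̃_i^n π ≠ 0}`. -/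
def phi (i : I) (f : ℝ → V) : ℕ := sSup {n | K.fIter i n f ≠ none}

/-- The Weyl group action on a normal crystal:
`S_i b = f̃_i^{⟨wt b, α_i∨⟩} b` if `⟨wt b, α_i∨⟩ ≥ 0` and
`S_i b = ẽ_i^{-⟨wt b, α_i∨⟩} b` if `⟨wt b, α_i∨⟩ ≤ 0`. -/
def Sop (i : I) (f : ℝ → V) : Option (ℝ → V) :=
  if 0 ≤ K.coroot i (f 1) then K.fIter i (⌊K.coroot i (f 1)⌋.toNat) f
  else K.eIter i ((-⌊K.coroot i (f 1)⌋).toNat) f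

/-- `SWord K [i₁, …, i_k] b = S_{i₁} S_{i₂} ⋯ S_{i_k} b`. -/
def SWord (K : KacMoodyData I V) : List I → Option (ℝ → V) → Option (ℝ → V)
  | [], o => o
  | i :: rest, o => (SWord K rest o).bind (K.Sop i)

/-- `b` is extremal: for each `w ∈ W` (as a word in simple reflections) and
`i ∈ I`, `ẽ_i (S_w b) = 0` if `⟨wt (S_w b), α_i∨⟩ ≥ 0` and `f̃_i (S_w b) = 0`
if `⟨wt (S_w b), α_i∨⟩ ≤ 0`. -/
def Extremal (f : ℝ → V) : Prop :=
  ∀ (l : List I) (g : ℝ → V), K.SWord l (some f) = some g →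
    ∀ i : I, (0 ≤ K.coroot i (g 1) → K.eop i g = none) ∧
      (K.coroot i (g 1) ≤ 0 → K.fop i g = none)

/-- Application of a word in the Kashiwara operators (`true` stands for `ẽ`,
`false` for `f̃`), leftmost entry applied first. -/
def applyWord (K : KacMoodyData I V) :
    List (I × Bool) → Option (ℝ → V) → Option (ℝ → V)
  | [], o => o
  | p :: rest, o =>
      applyWord K rest (o.bind fun f => if p.2 then K.eop p.1 f else K.fop p.1 f)

/-- `B(μ)^{*m}`: the set of `m`-fold concatenations of LS paths of shape `μ`. -/
def ConcatSet (μ : V) (m : ℕ) : Set (ℝ → V) :=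
  {g | ∃ l : List (ℝ → V), l.length = m ∧ (∀ f ∈ l, f ∈ K.B μ) ∧ g = concatList l}

/-- `ε_i` of a tensor product (encoded as a list of paths, Kashiwara's rule):
`ε_i(b₁ ⊗ b₂) = max (ε_i b₁) (ε_i b₂ - ⟨wt b₁, α_i∨⟩)`. -/
def tensEps (K : KacMoodyData I V) (i : I) : List (ℝ → V) → ℤ
  | [] => 0
  | [b] => (K.epsilon i b : ℤ)
  | b :: c :: rest =>
      max ((K.epsilon i b : ℤ)) (tensEps K i (c :: rest) - ⌊K.coroot i (b 1)⌋)

/-- `φ_i` of a tensor product (Kashiwara's rule):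
`φ_i(b₁ ⊗ b₂) = max (φ_i b₂) (φ_i b₁ + ⟨wt b₂, α_i∨⟩)`. -/
def tensPhi (K : KacMoodyData I V) (i : I) : List (ℝ → V) → ℤ
  | [] => 0
  | [b] => (K.phi i b : ℤ)
  | b :: c :: rest =>
      max (tensPhi K i (c :: rest)) ((K.phi i b : ℤ) + ⌊K.coroot i (tensWt (c :: rest))⌋)

/-- `ẽ_i` on a tensor product (Kashiwara's rule):
`ẽ_i(b₁ ⊗ b₂) = (ẽ_i b₁) ⊗ b₂` if `φ_i(b₁) ≥ ε_i(b₂)`, else `b₁ ⊗ (ẽ_i b₂)`. -/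
def tensE (K : KacMoodyData I V) (i : I) : List (ℝ → V) → Option (List (ℝ → V))
  | [] => none
  | [b] => (K.eop i b).map fun b' => [b']
  | b :: c :: rest =>
      if K.tensEps i (c :: rest) ≤ (K.phi i b : ℤ) then
        (K.eop i b).map fun b' => b' :: c :: rest
      else (tensE K i (c :: rest)).map fun r' => b :: r'

/-- `f̃_i` on a tensor product (Kashiwara's rule):
`f̃_i(b₁ ⊗ b₂) = (f̃_i b₁) ⊗ b₂` if `φ_i(b₁) > ε_i(b₂)`, else `b₁ ⊗ (f̃_i b₂)`. -/
def tensF (K : KacMoodyData I V) (i : I) : List (ℝ → V) → Option (List (ℝ → V))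
  | [] => none
  | [b] => (K.fop i b).map fun b' => [b']
  | b :: c :: rest =>
      if K.tensEps i (c :: rest) < (K.phi i b : ℤ) then
        (K.fop i b).map fun b' => b' :: c :: rest
      else (tensF K i (c :: rest)).map fun r' => b :: r'

/-- `ẽ_i^n` on tensor products. -/
def tensEIter (i : I) (n : ℕ) (l : List (ℝ → V)) : Option (List (ℝ → V)) :=
  (fun o => o.bind (K.tensE i))^[n] (some l)

/-- `f̃_i^n` on tensor products. -/
def tensFIter (i : I) (n : ℕ) (l : List (ℝ → V)) : Option (List (ℝ → V)) :=
  (fun o => o.bind (K.tensF i))^[n] (some l)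

end KacMoodyData

end LSPaper

namespace LSPaper

namespace KacMoodyData

variable {I V : Type*} [Fintype I] [DecidableEq I] [AddCommGroup V] [Module ℝ V]
variable (K : KacMoodyData I V)

/-! ### Simple reflections and words -/

lemma refl_apply (i : I) (x : V) : K.refl i x = x - K.coroot i x • K.α i := rfl

lemma coroot_self (i : I) : K.coroot i (K.α i) = 2 := by
  rw [K.cartanPairing, K.diag]; norm_num

lemma refl_refl (i : I) (x : V) : K.refl i (K.refl i x) = x := K.reflMap_invol i x

lemma coroot_refl (i : I) (x : V) : K.coroot i (K.refl i x) = -K.coroot i x := by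
  rw [refl_apply, map_sub, map_smul, coroot_self, smul_eq_mul]; ring

lemma refl_mul_self (i : I) : K.refl i * K.refl i = 1 :=
  LinearEquiv.ext fun x => K.refl_refl i x

lemma mul_refl_mul_refl (w : V ≃ₗ[ℝ] V) (i : I) : w * K.refl i * K.refl i = w := by
  rw [mul_assoc, refl_mul_self, mul_one]

/-- The product of the simple reflections of a word. -/
def wordProd (l : List I) : V ≃ₗ[ℝ] V := (l.map K.refl).prod

lemma wordProd_append (l l' : List I) :
    K.wordProd (l ++ l') = K.wordProd l * K.wordProd l' := by
  simp [wordProd]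

lemma wordProd_singleton (i : I) : K.wordProd [i] = K.refl i := by simp [wordProd]

/-- `w` is a product of at most `n` simple reflections. -/
def LenLE (n : ℕ) (w : V ≃ₗ[ℝ] V) : Prop := ∃ l : List I, l.length ≤ n ∧ K.wordProd l = w

variable {K}

lemma LenLE.mono {m n : ℕ} {w : V ≃ₗ[ℝ] V} (h : K.LenLE m w) (hmn : m ≤ n) : K.LenLE n w :=
  let ⟨l, hl, hw⟩ := h; ⟨l, hl.trans hmn, hw⟩

lemma LenLE.mul {m n : ℕ} {w w' : V ≃ₗ[ℝ] V} (h : K.LenLE m w) (h' : K.LenLE n w') :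
    K.LenLE (m + n) (w * w') := by
  obtain ⟨l, hl, rfl⟩ := h
  obtain ⟨l', hl', rfl⟩ := h'
  exact ⟨l ++ l', by simp; omega, K.wordProd_append l l'⟩

variable (K)

lemma lenLE_refl (i : I) : K.LenLE 1 (K.refl i) := ⟨[i], by simp, K.wordProd_singleton i⟩

lemma lenLE_one : K.LenLE 0 1 := ⟨[], by simp, rfl⟩

/-- `w` is a product of `n` simple reflections and of no fewer. -/
def HasLen (n : ℕ) (w : V ≃ₗ[ℝ] V) : Prop := K.LenLE n w ∧ ∀ m < n, ¬K.LenLE m w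

lemma exists_hasLen (l : List I) : ∃ n, K.HasLen n (K.wordProd l) := by
  have h : ∃ n, K.LenLE n (K.wordProd l) := ⟨_, l, le_rfl, rfl⟩
  exact ⟨Nat.find h, Nat.find_spec h, fun m hm => Nat.find_min h hm⟩

variable {K}

/-- If right multiplication by `r_i` shortens `w`, then it does so by exactly one. -/
lemma HasLen.mul_refl {n : ℕ} {w : V ≃ₗ[ℝ] V} (h : K.HasLen (n + 1) w) {i : I}
    (hi : K.LenLE n (w * K.refl i)) : K.HasLen n (w * K.refl i) := by
  refine ⟨hi, fun m hm h' => h.2 (m + 1) (by omega) ?_⟩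
  simpa only [K.mul_refl_mul_refl] using h'.mul (K.lenLE_refl i)

lemma HasLen.exists_mul_refl {n : ℕ} {w : V ≃ₗ[ℝ] V} (h : K.HasLen (n + 1) w) :
    ∃ i, K.LenLE n (w * K.refl i) := by
  obtain ⟨⟨l, hl, rfl⟩, h2⟩ := h
  rcases List.eq_nil_or_concat' l with rfl | ⟨l', i, rfl⟩
  · exact absurd ⟨[], by simp, rfl⟩ (h2 0 (by omega))
  · refine ⟨i, l', by simpa using hl, ?_⟩
    rw [wordProd_append, wordProd_singleton, mul_refl_mul_refl]

variable (K)

/-- The alternating product of `k` factors `r_s`, `r_t` whose last factor is `r_t`. -/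
def altProd : ℕ → I → I → (V ≃ₗ[ℝ] V)
  | 0, _, _ => 1
  | k + 1, s, t => altProd k t s * K.refl t

lemma lenLE_altProd (k : ℕ) (s t : I) : K.LenLE k (K.altProd k s t) := by
  induction k generalizing s t with
  | zero => exact K.lenLE_one
  | succ k ih => exact (ih t s).mul (K.lenLE_refl t)

lemma altProd_add (i j : ℕ) (s t : I) :
    ∃ u, K.LenLE i u ∧ K.altProd (i + j) s t = u * K.altProd j s t := by
  induction j generalizing s t with
  | zero => exact ⟨_, K.lenLE_altProd i s t, (mul_one _).symm⟩
  | succ j ih =>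
    obtain ⟨u, hu, h⟩ := ih t s
    exact ⟨u, hu, by rw [← add_assoc, altProd, h, altProd, mul_assoc]⟩

variable {K}

lemma HasLen.exists_altProd {n : ℕ} {w : V ≃ₗ[ℝ] V} (h : K.HasLen n w) {s : I} (t : I)
    (hs : ∀ m < n, ¬K.LenLE m (w * K.refl s)) :
    ∃ k m v, k + m = n ∧ w = v * K.altProd k s t ∧ K.HasLen m v ∧
      (∀ j < m, ¬K.LenLE j (v * K.refl s)) ∧ ∀ j < m, ¬K.LenLE j (v * K.refl t) := by
  induction n generalizing w s t with
  | zero => exact ⟨0, 0, w, rfl, (mul_one w).symm, h, by simp, by simp⟩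
  | succ n ih =>
    by_cases ht : K.LenLE n (w * K.refl t)
    · obtain ⟨k, m, v, hkm, hw, hv, h1, h2⟩ := ih (h.mul_refl ht) (s := t) s fun j hj => by
        rw [K.mul_refl_mul_refl]; exact h.2 j (by omega)
      refine ⟨k + 1, m, v, by omega, ?_, hv, h2, h1⟩
      rw [altProd, ← mul_assoc, ← hw, K.mul_refl_mul_refl]
    · exact ⟨0, n + 1, w, by omega, (mul_one w).symm, h, hs,
        fun j hj hj' => ht (hj'.mono (by omega))⟩

variable (K)

/-! ### Every real root is positive or negative -/

/-- The convex cone spanned by the simple roots. -/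
def PosCone : Set V := {v | ∃ c : I → ℝ, (∀ i, 0 ≤ c i) ∧ v = ∑ i, c i • K.α i}

lemma simple_mem_posCone (i : I) : K.α i ∈ K.PosCone :=
  ⟨fun j => if j = i then 1 else 0, fun j => by dsimp only; split_ifs <;> norm_num, by simp⟩

variable {K}

lemma PosCone.add {u v : V} (hu : u ∈ K.PosCone) (hv : v ∈ K.PosCone) : u + v ∈ K.PosCone := by
  obtain ⟨c, hc, rfl⟩ := hu
  obtain ⟨d, hd, rfl⟩ := hv
  exact ⟨c + d, fun i => add_nonneg (hc i) (hd i), by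
    simp [add_smul, Finset.sum_add_distrib]⟩

lemma PosCone.smul {v : V} (hv : v ∈ K.PosCone) {a : ℝ} (ha : 0 ≤ a) : a • v ∈ K.PosCone := by
  obtain ⟨c, hc, rfl⟩ := hv
  exact ⟨fun i => a * c i, fun i => mul_nonneg ha (hc i), by simp [Finset.smul_sum, mul_smul]⟩

lemma coeff_eq {c d : I → ℝ} (h : ∑ i, c i • K.α i = ∑ i, d i • K.α i) (i : I) : c i = d i := by
  have h' : ∑ i, (c i - d i) • K.α i = 0 := by
    simp [sub_smul, Finset.sum_sub_distrib, h]
  exact sub_eq_zero.1 (Fintype.linearIndependent_iff.1 K.rootsIndep _ h' i)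

lemma PosCone.eq_zero {v : V} (hv : v ∈ K.PosCone) (hv' : -v ∈ K.PosCone) : v = 0 := by
  obtain ⟨c, hc, rfl⟩ := hv
  obtain ⟨d, hd, h⟩ := hv'
  refine Finset.sum_eq_zero fun i _ => ?_
  have := K.coeff_eq (c := fun i => -c i) (d := d) (by simpa using h) i
  have h0 : c i = 0 := by linarith [hc i, hd i]
  rw [h0, zero_smul]

variable (K)

lemma refl_span (s t : I) (x y : ℝ) : K.refl t (x • K.α s + y • K.α t) =
    x • K.α s + (-(K.a t s : ℝ) * x - y) • K.α t := by
  rw [refl_apply, map_add, map_smul, map_smul, coroot_self, K.cartanPairing]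
  simp only [smul_eq_mul]
  module

/-- Outside the finite dihedral cases all alternating products keep the simple roots positive. -/
lemma exists_altProd_pos_of_four_le {s t : I} (hst : s ≠ t) (h4 : 4 ≤ K.a s t * K.a t s) (k : ℕ)
    (x y : ℝ) (hx : 0 ≤ x) (hy : 0 ≤ y) (hxy : -(K.a s t : ℝ) * y ≤ 2 * x) :
    ∃ x' y' : ℝ, 0 ≤ x' ∧ 0 ≤ y' ∧
      K.altProd k s t (x • K.α s + y • K.α t) = x' • K.α s + y' • K.α t := by
  induction k generalizing s t x y with
  | zero => exact ⟨x, y, hx, hy, rfl⟩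
  | succ k ih =>
    have h4' : (4 : ℝ) ≤ K.a s t * K.a t s := by exact_mod_cast h4
    have hp : (0 : ℝ) ≤ -K.a s t := by
      have := K.offDiag s t hst
      have : (K.a s t : ℝ) ≤ 0 := by exact_mod_cast this
      linarith
    have hq : (0 : ℝ) ≤ -K.a t s := by
      have := K.offDiag t s hst.symm
      have : (K.a t s : ℝ) ≤ 0 := by exact_mod_cast this
      linarith
    have h1 : 2 * y ≤ -(K.a t s : ℝ) * x := by
      have := mul_le_mul_of_nonneg_left hxy hq
      nlinarith
    obtain ⟨x', y', hx', hy', h⟩ := ih (s := t) (t := s) hst.symm (by rwa [mul_comm])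
      (-(K.a t s : ℝ) * x - y) x (by linarith) hx (by linarith)
    refine ⟨y', x', hy', hx', ?_⟩
    rw [altProd, LinearEquiv.mul_apply, refl_span, add_comm, h, add_comm]

lemma refl_add_span_right (s t : I) (x : V) (u v : ℝ) :
    K.refl t (x + u • K.α s + v • K.α t) =
      x + u • K.α s + (-(K.a t s : ℝ) * u - v - K.coroot t x) • K.α t := by
  rw [add_assoc, map_add, refl_span, refl_apply]
  module

lemma refl_add_span_left (s t : I) (x : V) (u v : ℝ) :
    K.refl s (x + u • K.α s + v • K.α t) =
      x + (-(K.a s t : ℝ) * v - u - K.coroot s x) • K.α s + v • K.α t := by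
  rw [add_right_comm, refl_add_span_right, add_right_comm]

/-- An alternating product ending in `r_t` sends `α_s` to a nonnegative combination of `α_s` and
`α_t`, as long as it is too short for the braid relation. -/
lemma altProd_pos_or_braid {s t : I} (hst : s ≠ t) (k : ℕ) :
    (∃ x y : ℝ, 0 ≤ x ∧ 0 ≤ y ∧ K.altProd k s t (K.α s) = x • K.α s + y • K.α t) ∨
      ∃ j, j + 1 ≤ k ∧ K.altProd (j + 1) s t = K.altProd (j + 1) t s := by
  by_cases h4 : 4 ≤ K.a s t * K.a t s
  · left
    simpa using K.exists_altProd_pos_of_four_le hst h4 k 1 0 zero_le_one le_rfl (by simp)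
  have hs0 := K.offDiag s t hst
  have ht0 := K.offDiag t s hst.symm
  have hz := K.zeroIff s t
  have split (j : ℕ)
      (h1 : ∀ x : V, K.altProd (j + 1) s t (x + (0 : ℝ) • K.α s + (0 : ℝ) • K.α t) =
        K.altProd (j + 1) t s (x + (0 : ℝ) • K.α s + (0 : ℝ) • K.α t))
      (h2 : ∀ i ≤ j, ∃ x y : ℝ, 0 ≤ x ∧ 0 ≤ y ∧
        K.altProd i s t (0 + (1 : ℝ) • K.α s + (0 : ℝ) • K.α t) =
          0 + x • K.α s + y • K.α t) :
      (∃ x y : ℝ, 0 ≤ x ∧ 0 ≤ y ∧ K.altProd k s t (K.α s) = x • K.α s + y • K.α t) ∨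
        ∃ j, j + 1 ≤ k ∧ K.altProd (j + 1) s t = K.altProd (j + 1) t s := by
    rcases le_or_gt (j + 1) k with hk | hk
    · exact Or.inr ⟨j, hk, LinearEquiv.ext fun x => by simpa using h1 x⟩
    · exact Or.inl (by simpa using h2 k (by omega))
  generalize hp : K.a s t = p at *
  generalize hq : K.a t s = q at *
  have hcases : (p = 0 ∧ q = 0) ∨ (p = -1 ∧ q = -1) ∨ (p = -1 ∧ q = -2) ∨ (p = -2 ∧ q = -1) ∨
      (p = -1 ∧ q = -3) ∨ (p = -3 ∧ q = -1) := by
    by_cases hp0 : p = 0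
    · exact Or.inl ⟨hp0, hz.1 hp0⟩
    · have hq0 : q ≠ 0 := fun h => hp0 (hz.2 h)
      have hp1 : p ≤ -1 := by omega
      have hq1 : q ≤ -1 := by omega
      have : -3 ≤ p := by nlinarith
      have : -3 ≤ q := by nlinarith
      clear hz split hp hq
      interval_cases p <;> interval_cases q <;> omega
  rcases hcases with ⟨rfl, rfl⟩ | ⟨rfl, rfl⟩ | ⟨rfl, rfl⟩ | ⟨rfl, rfl⟩ | ⟨rfl, rfl⟩ | ⟨rfl, rfl⟩
  on_goal 1 => refine split 1 (fun x => ?_) (fun i hi => ?_)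
  on_goal 3 => refine split 2 (fun x => ?_) (fun i hi => ?_)
  on_goal 5 => refine split 3 (fun x => ?_) (fun i hi => ?_)
  on_goal 7 => refine split 3 (fun x => ?_) (fun i hi => ?_)
  on_goal 9 => refine split 5 (fun x => ?_) (fun i hi => ?_)
  on_goal 11 => refine split 5 (fun x => ?_) (fun i hi => ?_)
  all_goals
    first
    | (interval_cases i <;>
        (simp only [altProd, LinearEquiv.mul_apply, LinearEquiv.coe_one, id_eq,
          refl_add_span_left, refl_add_span_right, hp, hq, map_zero]
         refine ⟨_, _, ?_, ?_, rfl⟩ <;> norm_num))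
    | (simp only [altProd, LinearEquiv.mul_apply, LinearEquiv.coe_one, id_eq,
          refl_add_span_left, refl_add_span_right, hp, hq]
       congr 3 <;> push_cast <;> ring)

lemma HasLen.apply_simple_mem_posCone {n : ℕ} {w : V ≃ₗ[ℝ] V} (h : K.HasLen n w) {s : I}
    (hs : ∀ m < n, ¬K.LenLE m (w * K.refl s)) : w (K.α s) ∈ K.PosCone := by
  induction n using Nat.strong_induction_on generalizing w s with
  | _ n ih =>
    rcases n with _ | n
    · obtain ⟨l, hl, rfl⟩ := h.1
      rw [List.eq_nil_of_length_eq_zero (Nat.le_zero.1 hl)]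
      exact K.simple_mem_posCone s
    · obtain ⟨t, ht⟩ := HasLen.exists_mul_refl h
      have hst : s ≠ t := fun hst => hs n (Nat.lt_succ_self n) (hst ▸ ht)
      obtain ⟨k, m, v, hkm, rfl, hv, hvs, hvt⟩ := HasLen.exists_altProd h t hs
      have hk : k ≠ 0 := by
        rintro rfl
        exact hvt n (by omega) (by simpa [altProd] using ht)
      have hs' := ih m (by omega) hv hvs
      have ht' := ih m (by omega) hv hvt
      rcases K.altProd_pos_or_braid hst k with ⟨x, y, hx, hy, hxy⟩ | ⟨j, hj, hb⟩
      · rw [LinearEquiv.mul_apply, hxy, map_add, map_smul, map_smul]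
        exact PosCone.add (PosCone.smul hs' hx) (PosCone.smul ht' hy)
      · exfalso
        obtain ⟨i, rfl⟩ := Nat.exists_eq_add_of_le' hj
        obtain ⟨u, hu, hu'⟩ := K.altProd_add i (j + 1) s t
        refine hs (m + (i + j)) (by omega) ?_
        rw [hu', hb, altProd, mul_assoc, mul_assoc, mul_refl_mul_refl]
        exact hv.1.mul (hu.mul (K.lenLE_altProd j s t))

lemma wordProd_simple_mem (l : List I) (s : I) :
    K.wordProd l (K.α s) ∈ K.PosCone ∨ -K.wordProd l (K.α s) ∈ K.PosCone := by
  obtain ⟨n, hn⟩ := K.exists_hasLen l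
  by_cases hs : ∀ m < n, ¬K.LenLE m (K.wordProd l * K.refl s)
  · exact Or.inl (HasLen.apply_simple_mem_posCone K hn hs)
  · push Not at hs
    obtain ⟨m, hm, hs⟩ := hs
    obtain ⟨n, rfl⟩ := Nat.exists_eq_add_of_lt hm
    right
    have h' := HasLen.mul_refl hn (hs.mono (by omega))
    have := HasLen.apply_simple_mem_posCone K h' (s := s) fun j hj => by
      rw [mul_refl_mul_refl]; exact hn.2 j (by omega)
    rwa [LinearEquiv.mul_apply, refl_apply, coroot_self, two_smul, sub_add_cancel_left,
      map_neg] at this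

/-- The pairs `(w α_i, w α_i∨)` of a real root and its coroot. -/
inductive IsRoot : V → (V →ₗ[ℝ] ℝ) → Prop
  | simple (i : I) : IsRoot (K.α i) (K.coroot i)
  | refl (i : I) {β : V} {c : V →ₗ[ℝ] ℝ} :
      IsRoot β c → IsRoot (K.refl i β) (c ∘ₗ (K.refl i : V →ₗ[ℝ] V))

variable {K}

lemma IsRoot.exists_word {β : V} {c : V →ₗ[ℝ] ℝ} (h : K.IsRoot β c) :
    ∃ l i, β = K.wordProd l (K.α i) := by
  induction h with
  | simple i => exact ⟨[], i, rfl⟩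
  | refl i _ ih =>
    obtain ⟨l, j, rfl⟩ := ih
    exact ⟨i :: l, j, by simp [wordProd]⟩

lemma IsRoot.pos_or_neg {β : V} {c : V →ₗ[ℝ] ℝ} (h : K.IsRoot β c) :
    β ∈ K.PosCone ∨ -β ∈ K.PosCone := by
  obtain ⟨l, i, rfl⟩ := h.exists_word
  exact K.wordProd_simple_mem l i

lemma IsRoot.apply_self {β : V} {c : V →ₗ[ℝ] ℝ} (h : K.IsRoot β c) : c β = 2 := by
  induction h with
  | simple i => exact K.coroot_self i
  | refl i _ ih => simpa [refl_refl] using ih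

/-- A coroot is determined by its root through the symmetrization of the Cartan matrix. -/
lemma IsRoot.exists_coeff {β : V} {c : V →ₗ[ℝ] ℝ} (h : K.IsRoot β c) :
    ∃ (n : I → ℝ) (e : ℝ), 0 < e ∧ β = ∑ k, n k • K.α k ∧
      e • c = ∑ k, (n k * K.d k) • K.coroot k := by
  induction h with
  | simple i =>
    refine ⟨fun j => if j = i then 1 else 0, K.d i, by exact_mod_cast K.dPos i, by simp, by simp⟩
  | @refl i β c _ ih =>
    obtain ⟨n, e, he, rfl, hc⟩ := ih
    refine ⟨fun k => n k - if k = i then ∑ j, n j * K.a i j else 0, e, he, ?_, ?_⟩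
    · rw [refl_apply, map_sum]
      simp [sub_smul, Finset.sum_sub_distrib, K.cartanPairing]
    · rw [← LinearMap.smul_comp, hc]
      ext x
      have hsym (k : I) : (K.d k : ℝ) * K.a k i = K.d i * K.a i k := by
        exact_mod_cast K.symmetrizable k i
      simp only [LinearMap.comp_apply, LinearEquiv.coe_coe, LinearMap.sum_apply,
        LinearMap.smul_apply, smul_eq_mul, refl_apply, map_sub, map_smul, K.cartanPairing,
        sub_mul, Finset.sum_sub_distrib, ite_mul, zero_mul, Finset.sum_ite_eq',
        Finset.mem_univ, if_true]
      congr 1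
      simp only [Finset.sum_mul, Finset.mul_sum]
      refine Finset.sum_congr rfl fun k _ => ?_
      linear_combination n k * K.coroot i x * hsym k

lemma IsRoot.smul_eq {β : V} {c : V →ₗ[ℝ] ℝ} (h : K.IsRoot β c) {i : I} {m : ℝ}
    (hβ : β = m • K.α i) : K.coroot i = m • c := by
  obtain ⟨n, e, he, hn, hc⟩ := h.exists_coeff
  have h1 := h.apply_self
  have hn' : n = fun k => if k = i then m else 0 :=
    funext fun k => K.coeff_eq (c := n) (d := fun k => if k = i then m else 0)
      (by rw [← hn, hβ]; simp) k
  simp only [hn', ite_mul, zero_mul, ite_smul, zero_smul, Finset.sum_ite_eq',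
    Finset.mem_univ, if_true] at hc
  have h2 : e * 2 = m * K.d i * (m * 2) := by
    have := LinearMap.congr_fun hc β
    rw [LinearMap.smul_apply, LinearMap.smul_apply, h1, hβ, map_smul, coroot_self] at this
    simpa using this
  have hmd : m * K.d i ≠ 0 := fun h0 => by rw [h0] at h2; linarith
  ext x
  have h3 : e * c x = m * K.d i * K.coroot i x := by simpa using LinearMap.congr_fun hc x
  apply mul_left_cancel₀ hmd
  rw [LinearMap.smul_apply, smul_eq_mul, ← h3, show e = m * K.d i * m by linarith]
  ring

/-- `r_i` permutes the positive real roots not proportional to `α_i`. -/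
lemma IsRoot.refl_mem_posCone {β : V} {c : V →ₗ[ℝ] ℝ} (h : K.IsRoot β c)
    (hβ : β ∈ K.PosCone) (i : I) (hi : ∀ m : ℝ, 0 < m → β ≠ m • K.α i) :
    K.refl i β ∈ K.PosCone := by
  refine (IsRoot.refl i h).pos_or_neg.resolve_right fun ⟨d, hd, hneg⟩ => ?_
  obtain ⟨n, hn, rfl⟩ := hβ
  have hz : ∀ k ≠ i, n k = 0 := by
    intro k hk
    have := K.coeff_eq (d := d)
      (c := fun k => -n k + if k = i then K.coroot i (∑ j, n j • K.α j) else 0)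
      (by rw [← hneg, refl_apply]; simp [add_smul, Finset.sum_add_distrib]; abel) k
    simp only [hk, if_false] at this
    linarith [hn k, hd k]
  have hni : ∑ k, n k • K.α k = n i • K.α i :=
    Finset.sum_eq_single i (fun k _ hk => by rw [hz k hk, zero_smul]) (by simp)
  rcases (hn i).eq_or_lt with h0 | h0
  · have := h.apply_self
    rw [hni, ← h0, zero_smul, map_zero] at this
    norm_num at this
  · exact hi _ h0 hni

variable (K)

/-! ### The order on weights and its covers -/

/-- `ξ'` is obtained from `ξ` by reflecting in a positive real root that pairs negatively. -/
def Step (ξ ξ' : V) : Prop :=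
  ∃ β c, K.IsRoot β c ∧ β ∈ K.PosCone ∧ c ξ < 0 ∧ ξ' = ξ - c ξ • β

lemma step_refl {i : I} {ξ : V} (h : K.coroot i ξ < 0) : K.Step ξ (K.refl i ξ) :=
  ⟨_, _, .simple i, K.simple_mem_posCone i, h, rfl⟩

lemma step_of_refl {i : I} {ξ : V} (h : 0 < K.coroot i ξ) : K.Step (K.refl i ξ) ξ := by
  simpa only [refl_refl] using
    K.step_refl (i := i) (ξ := K.refl i ξ) (by rw [coroot_refl]; linarith)

variable {K}

lemma Step.reflect {ξ ξ' : V} (h : K.Step ξ ξ') (i : I) :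
    K.Step (K.refl i ξ) (K.refl i ξ') ∨ (K.coroot i ξ < 0 ∧ ξ' = K.refl i ξ) := by
  obtain ⟨β, c, hr, hβ, hc, rfl⟩ := h
  by_cases hi : ∃ m : ℝ, 0 < m ∧ β = m • K.α i
  · obtain ⟨m, hm, hm'⟩ := hi
    have := hr.smul_eq hm'
    refine Or.inr ⟨?_, ?_⟩
    · rw [this]; exact mul_neg_of_pos_of_neg hm hc
    · rw [refl_apply, this, hm', LinearMap.smul_apply, smul_eq_mul]; module
  · push Not at hi
    exact Or.inl ⟨_, _, .refl i hr, hr.refl_mem_posCone hβ i hi, by simpa [refl_refl],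
      by simp [refl_refl]⟩

lemma Step.sub_mem {ξ ξ' : V} (h : K.Step ξ ξ') : ξ' - ξ ∈ K.PosCone ∧ ξ' ≠ ξ := by
  obtain ⟨β, c, hr, hβ, hc, rfl⟩ := h
  refine ⟨by rw [sub_sub_cancel_left, ← neg_smul]; exact PosCone.smul hβ (by linarith), fun h => ?_⟩
  have h0 : c ξ • β = 0 := by simpa using h
  have h1 := hr.apply_self
  rw [(smul_eq_zero.1 h0).resolve_left hc.ne, map_zero] at h1
  norm_num at h1

lemma Step.eq_refl {ξ ξ' : V} (h : K.Step ξ ξ') {i : I} {m : ℝ} (hm : ξ' - ξ = m • K.α i) :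
    ξ' = K.refl i ξ := by
  obtain ⟨β, c, hr, hβ, hc, rfl⟩ := h
  have hβ' : β = (m / -c ξ) • K.α i := by
    rw [div_eq_inv_mul, mul_smul, ← hm, sub_sub_cancel_left, ← neg_smul, smul_smul,
      inv_mul_cancel₀ (by linarith : -c ξ ≠ 0), one_smul]
  rw [refl_apply, hr.smul_eq hβ', LinearMap.smul_apply, smul_eq_mul]
  conv_lhs => rw [hβ']
  module

variable (K)

/-- `Chain p ξ ξ'`: there is a chain of `p` steps from `ξ` to `ξ'`. -/
def Chain : ℕ → V → V → Prop
  | 0, ξ, ξ' => ξ = ξ'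
  | p + 1, ξ, ξ' => ∃ η, K.Step ξ η ∧ Chain p η ξ'

variable {K}

lemma Chain.trans {p q : ℕ} {a b c : V} (h : K.Chain p a b) (h' : K.Chain q b c) :
    K.Chain (p + q) a c := by
  induction p generalizing a with
  | zero => rw [show a = b from h, Nat.zero_add]; exact h'
  | succ p ih =>
    obtain ⟨η, h1, h2⟩ := h
    rw [Nat.succ_add]
    exact ⟨η, h1, ih h2⟩

lemma Step.chain {a b : V} (h : K.Step a b) : K.Chain 1 a b := ⟨b, h, rfl⟩

lemma Chain.sub_mem {p : ℕ} {a b : V} (h : K.Chain p a b) : b - a ∈ K.PosCone := by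
  induction p generalizing a with
  | zero => exact ⟨0, by simp, by simp [show a = b from h]⟩
  | succ p ih =>
    obtain ⟨η, h1, h2⟩ := h
    simpa using PosCone.add (ih h2) h1.sub_mem.1

/-- The step between `r_i ξ` and `ξ` is a cover. -/
lemma Chain.length_le_one_of_refl {p : ℕ} {i : I} {ξ : V} (h : K.Chain p (K.refl i ξ) ξ) :
    p ≤ 1 := by
  rcases p with _ | p
  · omega
  obtain ⟨η, h1, h2⟩ := h
  have hη : η = ξ := by
    obtain ⟨c, hc, hc'⟩ := h1.sub_mem.1
    obtain ⟨d, hd, hd'⟩ := h2.sub_mem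
    have hsum : ∑ k, (c k + d k) • K.α k =
        ∑ k, (if k = i then K.coroot i ξ else 0) • K.α k := by
      simp only [add_smul, Finset.sum_add_distrib, ← hc', ← hd']
      simp [refl_apply]
    have hc0 : ∑ k, c k • K.α k = c i • K.α i := by
      refine Finset.sum_eq_single i (fun k _ hk => ?_) (by simp)
      have := K.coeff_eq hsum k
      simp only [hk, if_false] at this
      rw [show c k = 0 by linarith [hc k, hd k], zero_smul]
    rw [h1.eq_refl (hc'.trans hc0), refl_refl]
  subst hη
  rcases p with _ | p
  · omega
  obtain ⟨ζ, h3, h4⟩ := h2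
  exact absurd (sub_eq_zero.1 (PosCone.eq_zero h3.sub_mem.1 (by simpa using h4.sub_mem)))
    h3.sub_mem.2

variable (K)

/-- The smaller of `ξ` and `r_i ξ`. -/
def lower (i : I) (ξ : V) : V := if K.coroot i ξ < 0 then K.refl i ξ else ξ

/-- The larger of `ξ` and `r_i ξ`. -/
def upper (i : I) (ξ : V) : V := if 0 < K.coroot i ξ then K.refl i ξ else ξ

variable {K}

lemma Step.lower {ξ ξ' : V} (h : K.Step ξ ξ') (i : I) :
    ∃ p, K.Chain p (K.lower i ξ) (K.lower i ξ') ∧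
      1 + (if K.coroot i ξ' < 0 then 1 else 0) ≤ p + (if K.coroot i ξ < 0 then 1 else 0) := by
  unfold KacMoodyData.lower
  rcases h.reflect i with h' | ⟨h0, rfl⟩
  · split_ifs with h1 h2 h2
    · exact ⟨1, h'.chain, le_rfl⟩
    · rcases (not_lt.1 h2).eq_or_lt with h3 | h3
      · refine ⟨1, ?_, by omega⟩
        rw [show K.refl i ξ' = ξ' by rw [refl_apply, ← h3]; simp] at h'
        exact h'.chain
      · exact ⟨2, h'.chain.trans (K.step_of_refl h3).chain, by omega⟩
    · exact ⟨2, h.chain.trans (K.step_refl h2).chain, le_rfl⟩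
    · exact ⟨1, h.chain, le_rfl⟩
  · refine ⟨0, ?_, ?_⟩
    · simp only [h0, coroot_refl, if_true, neg_lt_zero, not_lt.2 h0.le, if_false]
      rfl
    · simp [h0, coroot_refl, h0.le]

lemma Step.upper {ξ ξ' : V} (h : K.Step ξ ξ') (i : I) :
    ∃ p, K.Chain p (K.upper i ξ) (K.upper i ξ') ∧
      1 + (if 0 < K.coroot i ξ then 1 else 0) ≤ p + (if 0 < K.coroot i ξ' then 1 else 0) := by
  unfold KacMoodyData.upper
  rcases h.reflect i with h' | ⟨h0, rfl⟩
  · split_ifs with h1 h2 h2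
    · exact ⟨1, h'.chain, le_rfl⟩
    · exact ⟨2, (K.step_of_refl h1).chain.trans h.chain, le_rfl⟩
    · rcases (not_lt.1 h1).eq_or_lt with h3 | h3
      · refine ⟨1, ?_, by omega⟩
        rw [show K.refl i ξ = ξ by rw [refl_apply, h3]; simp] at h'
        exact h'.chain
      · exact ⟨2, (K.step_refl h3).chain.trans h'.chain, by omega⟩
    · exact ⟨1, h.chain, le_rfl⟩
  · refine ⟨0, ?_, ?_⟩
    · simp only [h0, coroot_refl, if_true, neg_pos, not_lt.2 h0.le, if_false, refl_refl]
      rfl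
    · simp [h0, coroot_refl, h0.le]

lemma Chain.lower {p : ℕ} {ξ ξ' : V} (h : K.Chain p ξ ξ') (i : I) :
    ∃ q, K.Chain q (K.lower i ξ) (K.lower i ξ') ∧
      p + (if K.coroot i ξ' < 0 then 1 else 0) ≤ q + (if K.coroot i ξ < 0 then 1 else 0) := by
  induction p generalizing ξ with
  | zero => obtain rfl : ξ = ξ' := h; exact ⟨0, rfl, le_rfl⟩
  | succ p ih =>
    obtain ⟨η, h1, h2⟩ := h
    obtain ⟨q, hq, hq'⟩ := ih h2
    obtain ⟨r, hr, hr'⟩ := h1.lower i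
    exact ⟨r + q, hr.trans hq, by omega⟩

lemma Chain.upper {p : ℕ} {ξ ξ' : V} (h : K.Chain p ξ ξ') (i : I) :
    ∃ q, K.Chain q (K.upper i ξ) (K.upper i ξ') ∧
      p + (if 0 < K.coroot i ξ then 1 else 0) ≤ q + (if 0 < K.coroot i ξ' then 1 else 0) := by
  induction p generalizing ξ with
  | zero => obtain rfl : ξ = ξ' := h; exact ⟨0, rfl, le_rfl⟩
  | succ p ih =>
    obtain ⟨η, h1, h2⟩ := h
    obtain ⟨q, hq, hq'⟩ := ih h2
    obtain ⟨r, hr, hr'⟩ := h1.upper i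
    exact ⟨r + q, hr.trans hq, by omega⟩

variable (K)

/-- The root lattice. -/
def rootLattice : AddSubgroup V := AddSubgroup.closure (Set.range K.α)

lemma simple_mem_rootLattice (i : I) : K.α i ∈ K.rootLattice :=
  AddSubgroup.subset_closure ⟨i, rfl⟩

variable {K}

lemma exists_coroot_eq_of_mem_rootLattice {v : V} (hv : v ∈ K.rootLattice) (i : I) :
    ∃ n : ℤ, K.coroot i v = n := by
  refine K.pairingInt i v ?_
  have : K.rootLattice ≤ K.P :=
    (AddSubgroup.closure_le _).2 (Set.range_subset_iff.2 K.rootMem)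
  exact this hv

lemma exists_coeff_of_mem_rootLattice {v : V} (hv : v ∈ K.rootLattice) :
    ∃ n : I → ℤ, v = ∑ k, (n k : ℝ) • K.α k := by
  induction hv using AddSubgroup.closure_induction with
  | mem x hx =>
    obtain ⟨i, rfl⟩ := hx
    exact ⟨fun j => if j = i then 1 else 0, by simp⟩
  | zero => exact ⟨0, by simp⟩
  | add x y _ _ hx hy =>
    obtain ⟨m, rfl⟩ := hx
    obtain ⟨n, rfl⟩ := hy
    exact ⟨m + n, by simp [add_smul, Finset.sum_add_distrib]⟩
  | neg x _ hx =>
    obtain ⟨m, rfl⟩ := hx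
    exact ⟨-m, by simp⟩

lemma exists_int_of_smul_simple_mem {a : ℝ} {i : I} (h : a • K.α i ∈ K.rootLattice) :
    ∃ n : ℤ, a = n := by
  obtain ⟨n, hn⟩ := exists_coeff_of_mem_rootLattice h
  refine ⟨n i, ?_⟩
  simpa using K.coeff_eq (c := fun k => if k = i then a else 0) (d := fun k => n k)
    (by simpa using hn) i

lemma refl_mem_rootLattice {v : V} (hv : v ∈ K.rootLattice) (i : I) :
    K.refl i v ∈ K.rootLattice := by
  obtain ⟨n, hn⟩ := exists_coroot_eq_of_mem_rootLattice hv i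
  rw [refl_apply, hn, Int.cast_smul_eq_zsmul]
  exact sub_mem hv (zsmul_mem (K.simple_mem_rootLattice i) n)

variable (K)

/-- A cover `ξ > ξ'` for the order on weights with `σ (ξ' - ξ)` in the root lattice. -/
def SCover (σ : ℝ) (ξ ξ' : V) : Prop :=
  K.Step ξ ξ' ∧ (∀ p, K.Chain p ξ ξ' → p ≤ 1) ∧ σ • (ξ' - ξ) ∈ K.rootLattice

/-- There is a (possibly empty) `σ`-chain from `ξ` to `ξ'`. -/
def SRel (σ : ℝ) : V → V → Prop := Relation.ReflTransGen (K.SCover σ)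

variable {K} {σ : ℝ} {ξ ξ' : V} {i : I}

lemma SCover.eq_refl (h : K.SCover σ ξ ξ') (h1 : K.coroot i ξ ≤ 0) (h2 : 0 ≤ K.coroot i ξ')
    (h3 : K.coroot i ξ < 0 ∨ 0 < K.coroot i ξ') : ξ' = K.refl i ξ := by
  refine (h.1.reflect i).elim (fun h' => ?_) And.right
  have fix {ζ : V} (hζ : 0 = K.coroot i ζ) : K.refl i ζ = ζ := by
    rw [refl_apply, ← hζ, zero_smul, sub_zero]
  exfalso
  rcases h1.lt_or_eq with h1 | h1 <;> rcases h2.lt_or_eq with h2 | h2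
  · have := h.2.1 _ ((K.step_refl h1).chain.trans (h'.chain.trans (K.step_of_refl h2).chain))
    omega
  · rw [fix h2] at h'
    have := h.2.1 _ ((K.step_refl h1).chain.trans h'.chain)
    omega
  · rw [fix h1.symm] at h'
    have := h.2.1 _ (h'.chain.trans (K.step_of_refl h2).chain)
    omega
  · rcases h3 with h3 | h3 <;> linarith

lemma SCover.exists_int_of_eq_refl (h : K.SCover σ ξ ξ') (h' : ξ' = K.refl i ξ) :
    ∃ n : ℤ, σ * K.coroot i ξ = n := by
  have := neg_mem h.2.2
  rw [h', refl_apply, sub_sub_cancel_left, smul_neg, neg_neg, smul_smul] at this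
  exact exists_int_of_smul_simple_mem this

lemma scover_refl (h : 0 < K.coroot i ξ) (hσ : ∃ n : ℤ, σ * K.coroot i ξ = n) :
    K.SCover σ (K.refl i ξ) ξ := by
  refine ⟨K.step_of_refl h, fun p => Chain.length_le_one_of_refl, ?_⟩
  obtain ⟨n, hn⟩ := hσ
  rw [refl_apply, sub_sub_cancel, smul_smul, hn, Int.cast_smul_eq_zsmul]
  exact zsmul_mem (K.simple_mem_rootLattice i) n

lemma scover_refl' (h : K.coroot i ξ < 0) (hσ : ∃ n : ℤ, σ * K.coroot i ξ = n) :
    K.SCover σ ξ (K.refl i ξ) := by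
  obtain ⟨n, hn⟩ := hσ
  have := scover_refl (ξ := K.refl i ξ) (i := i) (σ := σ)
    (by rw [coroot_refl]; linarith) ⟨-n, by rw [coroot_refl, mul_neg, hn]; simp⟩
  rwa [refl_refl] at this

lemma SCover.reflect (h : K.SCover σ ξ ξ') (hs : 0 < K.coroot i ξ * K.coroot i ξ') :
    K.SCover σ (K.refl i ξ) (K.refl i ξ') := by
  refine ⟨(h.1.reflect i).resolve_right fun h' => ?_, fun p hp => ?_, ?_⟩
  · rw [h'.2, coroot_refl] at hs
    nlinarith
  · rcases pos_and_pos_or_neg_and_neg_of_mul_pos hs with ⟨h1, h2⟩ | ⟨h1, h2⟩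
    · obtain ⟨q, hq, hq'⟩ := hp.lower i
      simp only [KacMoodyData.lower, coroot_refl, neg_lt_zero, h1, h2, if_true, refl_refl] at hq hq'
      have := h.2.1 q hq
      omega
    · obtain ⟨q, hq, hq'⟩ := hp.upper i
      simp only [KacMoodyData.upper, coroot_refl, neg_pos, h1, h2, if_true, refl_refl] at hq hq'
      have := h.2.1 q hq
      omega
  · rw [← map_sub, ← map_smul]
    exact refl_mem_rootLattice h.2.2 i

lemma SRel.smul_sub_mem (h : K.SRel σ ξ ξ') : σ • (ξ' - ξ) ∈ K.rootLattice := by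
  induction h with
  | refl => simp
  | tail _ h ih => simpa [← smul_add] using add_mem h.2.2 ih

lemma SRel.exists_int_sub (h : K.SRel σ ξ ξ') (i : I) :
    ∃ n : ℤ, σ * K.coroot i ξ' - σ * K.coroot i ξ = n := by
  obtain ⟨n, hn⟩ := exists_coroot_eq_of_mem_rootLattice h.smul_sub_mem i
  exact ⟨n, by rw [← hn, map_smul, map_sub, smul_eq_mul, mul_sub]⟩

lemma SRel.exists_int_iff (h : K.SRel σ ξ ξ') (i : I) :
    (∃ n : ℤ, σ * K.coroot i ξ = n) ↔ ∃ n : ℤ, σ * K.coroot i ξ' = n := by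
  obtain ⟨m, hm⟩ := h.exists_int_sub i
  constructor <;> rintro ⟨n, hn⟩
  · exact ⟨n + m, by push_cast; linarith⟩
  · exact ⟨n - m, by push_cast; linarith⟩

/-- A chain along which `⟨·, α_i∨⟩` becomes positive passes through the reflection `r_i`. -/
lemma SRel.exists_int_of_nonpos_of_pos (h : K.SRel σ ξ ξ') (h1 : K.coroot i ξ ≤ 0)
    (h2 : 0 < K.coroot i ξ') : ∃ n : ℤ, σ * K.coroot i ξ = n := by
  induction h with
  | refl => linarith
  | @tail η ζ h h' ih =>
    rcases le_or_gt (K.coroot i η) 0 with h3 | h3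
    · rw [SRel.exists_int_iff h i]
      exact h'.exists_int_of_eq_refl (h'.eq_refl h3 h2.le (.inr h2))
    · exact ih h3

lemma SRel.exists_int_of_neg_of_nonneg (h : K.SRel σ ξ ξ') (h1 : K.coroot i ξ < 0)
    (h2 : 0 ≤ K.coroot i ξ') : ∃ n : ℤ, σ * K.coroot i ξ = n := by
  induction h using Relation.ReflTransGen.head_induction_on with
  | refl => linarith
  | @head η ζ h' h ih =>
    rcases lt_or_ge (K.coroot i ζ) 0 with h3 | h3
    · rw [SRel.exists_int_iff (Relation.ReflTransGen.single h') i]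
      exact ih h3
    · exact h'.exists_int_of_eq_refl (h'.eq_refl h1.le h3 (.inl h1))

lemma SRel.refl_right (h : K.SRel σ ξ ξ') (h1 : K.coroot i ξ ≤ 0)
    (h2 : 0 < K.coroot i ξ') : K.SRel σ ξ (K.refl i ξ') := by
  induction h with
  | refl => linarith
  | @tail η ζ h h' ih =>
    rcases le_or_gt (K.coroot i η) 0 with h3 | h3
    · rwa [h'.eq_refl h3 h2.le (.inr h2), refl_refl]
    · exact (ih h3).tail (h'.reflect (mul_pos h3 h2))

lemma SRel.refl_left (h : K.SRel σ ξ ξ') (h1 : K.coroot i ξ < 0)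
    (h2 : 0 ≤ K.coroot i ξ') : K.SRel σ (K.refl i ξ) ξ' := by
  induction h using Relation.ReflTransGen.head_induction_on with
  | refl => linarith
  | @head η ζ h' h ih =>
    rcases lt_or_ge (K.coroot i ζ) 0 with h3 | h3
    · exact (ih h3).head (h'.reflect (mul_pos_of_neg_of_neg h1 h3))
    · rwa [← h'.eq_refl h1.le h3 (.inl h1)]

lemma SRel.reflect_of_pos (h : K.SRel σ ξ ξ') (h1 : ¬∃ n : ℤ, σ * K.coroot i ξ = n)
    (h2 : 0 < K.coroot i ξ') : K.SRel σ (K.refl i ξ) (K.refl i ξ') := by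
  induction h with
  | refl => exact .refl
  | @tail η ζ h h' ih =>
    rcases le_or_gt (K.coroot i η) 0 with h3 | h3
    · rw [SRel.exists_int_iff h i] at h1
      exact absurd (h'.exists_int_of_eq_refl (h'.eq_refl h3 h2.le (.inr h2))) h1
    · exact (ih h3).tail (h'.reflect (mul_pos h3 h2))

lemma SRel.reflect_of_neg (h : K.SRel σ ξ ξ') (h1 : ¬∃ n : ℤ, σ * K.coroot i ξ = n)
    (h2 : K.coroot i ξ < 0) : K.SRel σ (K.refl i ξ) (K.refl i ξ') := by
  induction h using Relation.ReflTransGen.head_induction_on with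
  | refl => exact .refl
  | @head η ζ h' h ih =>
    rcases lt_or_ge (K.coroot i ζ) 0 with h3 | h3
    · refine (ih ?_ h3).head (h'.reflect (mul_pos_of_neg_of_neg h2 h3))
      rwa [← SRel.exists_int_iff (Relation.ReflTransGen.single h') i]
    · exact absurd (h'.exists_int_of_eq_refl (h'.eq_refl h2.le h3 (.inl h2))) h1

end KacMoodyData

/-! ### Piecewise-linear paths with breakpoints in `(1/N)ℤ` -/

lemma clamp01_of_nonpos {t : ℝ} (h : t ≤ 0) : clamp01 t = 0 :=
  max_eq_left ((min_le_right _ _).trans h)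

lemma clamp01_of_one_le {t : ℝ} (h : 1 ≤ t) : clamp01 t = 1 := by
  rw [clamp01, min_eq_left h, max_eq_right zero_le_one]

lemma clamp01_of_mem {t : ℝ} (h0 : 0 ≤ t) (h1 : t ≤ 1) : clamp01 t = t := by
  rw [clamp01, min_eq_right h1, max_eq_right h0]

lemma clamp01_nonneg (t : ℝ) : 0 ≤ clamp01 t := le_max_left _ _

lemma clamp01_le_one (t : ℝ) : clamp01 t ≤ 1 := max_le zero_le_one (min_le_left _ _)

lemma sum_clamp01 (c : ℕ) (z : ℝ) :
    ∑ r ∈ Finset.range c, clamp01 (z - r) = max 0 (min (c : ℝ) z) := by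
  induction c with
  | zero => simp
  | succ c ih =>
    have hc : (0 : ℝ) ≤ c := c.cast_nonneg
    rw [Finset.sum_range_succ, ih, clamp01]
    push_cast
    rcases le_total z c with h | h
    · rw [min_eq_right h, min_eq_right (by linarith : z ≤ c + 1),
        min_eq_right (by linarith : z - c ≤ 1), max_eq_left (by linarith : z - c ≤ 0), add_zero]
    · rw [min_eq_left h, max_eq_right hc]
      rcases le_total z (c + 1) with h' | h'
      · rw [min_eq_right h', min_eq_right (by linarith : z - c ≤ 1), max_eq_right (by linarith),
          max_eq_right (by linarith)]
        ring
      · rw [min_eq_left h', min_eq_left (by linarith : 1 ≤ z - c), max_eq_right zero_le_one,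
          max_eq_right (by linarith)]

lemma sum_clamp01_mul {N j : ℕ} (hj : j < N) (x : ℕ → ℝ) {s : ℝ} (h0 : (j : ℝ) ≤ s)
    (h1 : s ≤ j + 1) :
    ∑ k ∈ Finset.range N, clamp01 (s - k) * x k = ∑ k ∈ Finset.range j, x k + (s - j) * x j := by
  induction N, hj using Nat.le_induction with
  | base =>
    rw [Finset.sum_range_succ, clamp01_of_mem (by linarith) (by linarith)]
    congr 1
    refine Finset.sum_congr rfl fun k hk => ?_
    have : (k : ℝ) + 1 ≤ j := by exact_mod_cast Finset.mem_range.1 hk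
    rw [clamp01_of_one_le (by linarith), one_mul]
  | succ N hN ih =>
    have : (j : ℝ) + 1 ≤ N := by exact_mod_cast hN
    rw [Finset.sum_range_succ, ih, clamp01_of_nonpos (by linarith), zero_mul, add_zero]

variable {I V : Type*} [Fintype I] [DecidableEq I] [AddCommGroup V] [Module ℝ V]

/-- The path whose direction on `[k/N, (k+1)/N]` is `ν k`. -/
def polyPath (N : ℕ) (ν : ℕ → V) : ℝ → V := fun t =>
  ∑ k ∈ Finset.range N, (clamp01 (N * t - k) / N) • ν k

lemma polyPath_one (ν : ℕ → V) : polyPath 1 ν = straight (ν 0) := by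
  funext t
  simp [polyPath, straight]

lemma sum_range_mul_div (N : ℕ) {c : ℕ} (hc : 0 < c) (F : ℕ → ℝ) (ν : ℕ → V) :
    ∑ k ∈ Finset.range (N * c), F k • ν (k / c) =
      ∑ j ∈ Finset.range N, (∑ r ∈ Finset.range c, F (j * c + r)) • ν j := by
  induction N with
  | zero => simp
  | succ N ih =>
    rw [Nat.succ_mul, Finset.sum_range_add, ih, Finset.sum_range_succ, Finset.sum_smul]
    congr 1
    refine Finset.sum_congr rfl fun r hr => ?_
    rw [mul_comm N c, Nat.mul_add_div hc, Nat.div_eq_of_lt (Finset.mem_range.1 hr), add_zero]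

lemma polyPath_refine (N : ℕ) {c : ℕ} (hc : 0 < c) (ν : ℕ → V) :
    polyPath (N * c) (fun k => ν (k / c)) = polyPath N ν := by
  funext t
  rw [polyPath, sum_range_mul_div N hc]
  refine Finset.sum_congr rfl fun j _ => ?_
  congr 1
  have hc' : (0 : ℝ) < c := by exact_mod_cast hc
  have h : ∀ r : ℕ, clamp01 (((N * c : ℕ) : ℝ) * t - ((j * c + r : ℕ) : ℝ)) =
      clamp01 (c * (N * t - j) - r) := fun r => by push_cast; ring_nf
  simp only [h, ← Finset.sum_div, sum_clamp01]
  have h2 : max 0 (min (c : ℝ) (c * (N * t - j))) = c * clamp01 (N * t - j) := by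
    rw [clamp01, mul_max_of_nonneg _ _ hc'.le, mul_min_of_nonneg _ _ hc'.le, mul_zero, mul_one]
  rw [h2]
  push_cast
  rw [mul_comm (N : ℝ) c, mul_div_mul_left _ _ hc'.ne']

lemma sigmaMap_polyPath {N : ℕ} (hN : 0 < N) (ν : ℕ → V) :
    SigmaMap N (polyPath N ν) = List.ofFn fun j : Fin N => straight (ν j) := by
  have hN' : (N : ℝ) ≠ 0 := by positivity
  refine congrArg List.ofFn (funext fun k => funext fun t => ?_)
  have h0 := clamp01_nonneg t
  have h1 := clamp01_le_one t
  simp only [dilate, polyPath, straight, mul_div_cancel₀ _ hN',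
    ← Finset.sum_sub_distrib, ← sub_smul, Finset.smul_sum, smul_smul]
  rw [Finset.sum_eq_single (k : ℕ)]
  · rw [add_sub_cancel_right, sub_self, clamp01_of_mem h0 h1, clamp01_of_nonpos le_rfl, sub_zero]
  · intro j _ hj
    rcases lt_or_gt_of_ne hj with hj | hj
    · have : (j : ℝ) + 1 ≤ k := by exact_mod_cast hj
      rw [clamp01_of_one_le (by linarith), clamp01_of_one_le (by linarith), sub_self,
        zero_smul]
    · have : (k : ℝ) + 1 ≤ j := by exact_mod_cast hj
      rw [clamp01_of_nonpos (by linarith), clamp01_of_nonpos (by linarith), sub_self,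
        zero_smul]
  · intro hk
    exact absurd (Finset.mem_range.2 k.2) hk

/-! ### Integer height functions -/

/-- The partial sums of `x`. -/
def height (x : ℕ → ℤ) (k : ℕ) : ℤ := ∑ j ∈ Finset.range k, x j

lemma height_zero (x : ℕ → ℤ) : height x 0 = 0 := rfl

lemma height_succ (x : ℕ → ℤ) (k : ℕ) : height x (k + 1) = height x k + x k :=
  Finset.sum_range_succ _ _

/-- The height function takes values in `Nℤ` only at integer arguments. -/
def NoCross (N : ℕ) (x : ℕ → ℤ) : Prop :=
  ∀ k < N, ∀ n : ℤ, (height x k < N * n → height x (k + 1) ≤ N * n) ∧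
    (N * n < height x k → N * n ≤ height x (k + 1))

lemma dvd_height_refine {c : ℕ} (hc : 0 < c) (x : ℕ → ℤ) (k : ℕ) :
    (c : ℤ) ∣ height (fun k => x (k / c)) k - (k % c : ℕ) * x (k / c) := by
  induction k with
  | zero => simp [height_zero]
  | succ k ih =>
    have hlt := Nat.mod_lt k hc
    have hk := Nat.div_add_mod k c
    obtain ⟨z, hz⟩ := ih
    rw [height_succ]
    rcases Nat.lt_or_ge (k % c + 1) c with h | h
    · have hq : (k + 1) / c = k / c := by
        conv_lhs => rw [← hk, add_assoc, Nat.mul_add_div hc, Nat.div_eq_of_lt h, add_zero]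
      have hr : (k + 1) % c = k % c + 1 := by
        conv_lhs => rw [← hk, add_assoc, Nat.mul_add_mod, Nat.mod_eq_of_lt h]
      refine ⟨z, ?_⟩
      rw [hq, hr, Nat.cast_add, Nat.cast_one]
      linarith
    · have hc' : k % c + 1 = c := by omega
      have hr : (k + 1) % c = 0 := by
        conv_lhs => rw [← hk, add_assoc, Nat.mul_add_mod, hc', Nat.mod_self]
      have h2 : ((k % c : ℕ) : ℤ) = c - 1 := by omega
      refine ⟨z + x (k / c), ?_⟩
      rw [hr]
      rw [h2] at hz
      push_cast
      linarith

lemma exists_noCross_refine (N : ℕ) (x : ℕ → ℤ) :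
    ∃ c, 0 < c ∧ NoCross (N * c) fun k => x (k / c) := by
  set b : ℕ → ℕ := fun k => if x k = 0 then 1 else (x k).natAbs with hb
  have hpos : 0 < ∏ k ∈ Finset.range N, b k := by
    refine Finset.prod_pos fun k _ => ?_
    rw [hb]
    dsimp only
    split_ifs with h
    · exact one_pos
    · exact Int.natAbs_pos.2 h
  refine ⟨_, hpos, ?_⟩
  set c := ∏ k ∈ Finset.range N, b k with hc
  intro k hk n
  have hkN : k / c < N := Nat.div_lt_of_lt_mul (by rwa [mul_comm])
  rw [height_succ]
  have hdvd := dvd_height_refine hpos x k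
  set Y := height (fun k => x (k / c)) k
  rcases eq_or_ne (x (k / c)) 0 with h0 | h0
  · rw [h0]
    constructor <;> intro <;> linarith
  have hxc : x (k / c) ∣ c := by
    have : b (k / c) ∣ c := Finset.dvd_prod_of_mem b (Finset.mem_range.2 hkN)
    rw [hb] at this
    simp only [h0, if_false] at this
    exact Int.natAbs_dvd.1 (Int.natCast_dvd_natCast.2 this)
  have hd : x (k / c) ∣ ((N * c : ℕ) : ℤ) * n - Y := by
    have h1 := (dvd_sub_left (Dvd.intro_left _ rfl)).1 (hxc.trans hdvd)
    refine dvd_sub ?_ h1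
    push_cast
    exact (hxc.mul_left _).mul_right _
  constructor <;> intro h
  · have := Int.le_of_dvd (by linarith) hd
    linarith
  · have := Int.le_of_dvd (by linarith : 0 < Y - ((N * c : ℕ) : ℤ) * n)
      (neg_dvd.2 (dvd_sub_comm.1 hd))
    linarith

/-- The data entering the definition of `ẽ_i`: the first minimum of the height function and the
last time before it at which the height is larger by `N`. -/
lemma exists_raising_interval {N : ℕ} (hN : 0 < N) {x : ℕ → ℤ} (hx : NoCross N x)
    (hturn : ∀ k, k + 1 < N → x k < 0 → 0 ≤ x (k + 1) → (N : ℤ) ∣ height x (k + 1))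
    (hlast : (N : ℤ) ∣ height x N) (hneg : ∃ k ≤ N, height x k < 0) :
    ∃ (m : ℤ) (k₀ k₁ : ℕ), k₀ < k₁ ∧ k₁ ≤ N ∧ (∀ k ≤ N, N * m ≤ height x k) ∧
      height x k₁ = N * m ∧ (∀ k < k₁, N * m < height x k) ∧ height x k₀ = N * m + N ∧
      (∀ k, k₀ < k → k ≤ k₁ → height x k < N * m + N) ∧ ∀ k, k₀ ≤ k → k < k₁ → x k < 0 := by
  obtain ⟨kmin, hkmin, hmin⟩ := Finset.exists_min_image (Finset.range (N + 1)) (height x)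
    ⟨0, by simp⟩
  have hex : ∃ k, k ≤ N ∧ height x k = height x kmin :=
    ⟨kmin, by simpa [Nat.lt_succ_iff] using hkmin, rfl⟩
  obtain ⟨hk₁, hk₁'⟩ := Nat.find_spec hex
  have hfirst : ∀ k < Nat.find hex, height x kmin < height x k := fun k hk =>
    (hmin k (by simp; omega)).lt_of_ne fun h => Nat.find_min hex hk ⟨by omega, h.symm⟩
  replace hmin : ∀ k ≤ N, height x kmin ≤ height x k := fun k hk => hmin k (by simp; omega)
  generalize Nat.find hex = k₁ at *
  generalize height x kmin = M at *
  have hM : M < 0 := by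
    obtain ⟨k, hk, hk'⟩ := hneg
    exact (hmin k hk).trans_lt hk'
  obtain ⟨k, rfl⟩ : ∃ k, k₁ = k + 1 := Nat.exists_eq_succ_of_ne_zero fun h => by
    rw [h, height_zero] at hk₁'; omega
  have hMN : (N : ℤ) ∣ M := by
    rcases hk₁.eq_or_lt with h | h
    · rw [← hk₁', h]; exact hlast
    · rw [← hk₁']
      refine hturn k h ?_ ?_
      · have := hfirst k (by omega)
        rw [height_succ] at hk₁'; omega
      · have := hmin (k + 2) (by omega)
        rw [height_succ] at this; omega
  obtain ⟨m, rfl⟩ := hMN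
  have hN' : (0 : ℤ) < N := by exact_mod_cast hN
  have hm : m + 1 ≤ 0 := by
    by_contra! h
    have := mul_nonneg hN'.le (by omega : 0 ≤ m)
    omega
  have h00 : (N : ℤ) * m + N ≤ height x 0 := by
    rw [height_zero]; nlinarith
  set k₀ := Nat.findGreatest (fun j => (N : ℤ) * m + N ≤ height x j) (k + 1) with hk₀
  have hk₀' : (N : ℤ) * m + N ≤ height x k₀ :=
    Nat.findGreatest_spec (P := fun j => (N : ℤ) * m + N ≤ height x j) (Nat.zero_le _) h00
  have hk₀le : k₀ ≤ k + 1 := Nat.findGreatest_le _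
  have hk₀lt : k₀ < k + 1 := hk₀le.lt_of_ne fun h => by rw [h] at hk₀'; omega
  have hbelow : ∀ j, k₀ < j → j ≤ k + 1 → height x j < N * m + N := fun j h1 h2 =>
    not_le.1 (Nat.findGreatest_is_greatest h1 h2)
  have heq : height x k₀ = N * m + N := by
    refine le_antisymm (not_lt.1 fun h => ?_) hk₀'
    have h1 := hbelow (k₀ + 1) (by omega) (by omega)
    have h2 := (hx k₀ (by omega) (m + 1)).2 (by linarith)
    linarith
  refine ⟨m, k₀, k + 1, hk₀lt, hk₁, hmin, hk₁', hfirst, heq, hbelow, fun j hj => ?_⟩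
  induction j, hj using Nat.le_induction with
  | base =>
    intro _
    have := hbelow (k₀ + 1) (by omega) (by omega)
    rw [height_succ] at this
    omega
  | succ j hj ih =>
    intro hjk
    by_contra! h
    obtain ⟨n, hn⟩ := hturn j (by omega) (ih (by omega)) h
    have h1 := hbelow (j + 1) (by omega) (by omega)
    have h2 := hfirst (j + 1) hjk
    rw [hn] at h1 h2
    have h3 : m < n := lt_of_mul_lt_mul_left h2 hN'.le
    have h4 : n < m + 1 := lt_of_mul_lt_mul_left (by linarith) hN'.le
    omega

/-- The data entering the definition of `f̃_i`: the last minimum of the height function and the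
first time after it at which the height is larger by `N`. -/
lemma exists_lowering_interval {N : ℕ} (hN : 0 < N) {x : ℕ → ℤ} (hx : NoCross N x)
    (hturn : ∀ k, k + 1 < N → x k ≤ 0 → 0 < x (k + 1) → (N : ℤ) ∣ height x (k + 1))
    (hlast : (N : ℤ) ∣ height x N) (hneg : ∃ k ≤ N, height x k < height x N) :
    ∃ (m : ℤ) (k₀ k₁ : ℕ), k₀ < k₁ ∧ k₁ ≤ N ∧ (∀ k ≤ N, N * m ≤ height x k) ∧
      height x k₀ = N * m ∧ (∀ k, k₀ < k → k ≤ N → N * m < height x k) ∧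
      height x k₁ = N * m + N ∧
      (∀ k, k₀ ≤ k → k < k₁ → height x k < N * m + N) ∧ ∀ k, k₀ ≤ k → k < k₁ → 0 < x k := by
  obtain ⟨kmin, hkmin, hmin⟩ := Finset.exists_min_image (Finset.range (N + 1)) (height x)
    ⟨0, by simp⟩
  replace hmin : ∀ k ≤ N, height x kmin ≤ height x k := fun k hk => hmin k (by simp; omega)
  replace hkmin : kmin ≤ N := by simpa [Nat.lt_succ_iff] using hkmin
  set k₀ := Nat.findGreatest (fun k => height x k = height x kmin) N with hk₀
  have hk₀' : height x k₀ = height x kmin :=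
    Nat.findGreatest_spec (P := fun k => height x k = height x kmin) hkmin rfl
  have hk₀N : k₀ ≤ N := Nat.findGreatest_le _
  have habove : ∀ k, k₀ < k → k ≤ N → height x kmin < height x k := fun k h1 h2 =>
    (hmin k h2).lt_of_ne fun h =>
      Nat.findGreatest_is_greatest (P := fun k => height x k = height x kmin) h1 h2 h.symm
  clear_value k₀
  generalize height x kmin = M at *
  have hM : M < height x N := by
    obtain ⟨k, hk, hk'⟩ := hneg
    exact (hmin k hk).trans_lt hk'
  have hk₀lt : k₀ < N := hk₀N.lt_of_ne fun h => by rw [h] at hk₀'; omega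
  have hMN : (N : ℤ) ∣ M := by
    rw [← hk₀']
    rcases k₀ with _ | k
    · exact dvd_zero _
    · refine hturn k hk₀lt ?_ ?_
      · have := hmin k (by omega)
        rw [height_succ] at hk₀'; omega
      · have := habove (k + 2) (by omega) (by omega)
        rw [height_succ] at this; omega
  obtain ⟨m, rfl⟩ := hMN
  have hN' : (0 : ℤ) < N := by exact_mod_cast hN
  have hex : ∃ k, k₀ ≤ k ∧ N * m + N ≤ height x k := by
    obtain ⟨n, hn⟩ := hlast
    refine ⟨N, hk₀N, ?_⟩
    rw [hn] at hM ⊢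
    have : m + 1 ≤ n := lt_of_mul_lt_mul_left hM hN'.le
    nlinarith
  obtain ⟨hk₁, hk₁'⟩ := Nat.find_spec hex
  have hk₁N : Nat.find hex ≤ N := by
    refine Nat.find_min' hex ⟨hk₀N, ?_⟩
    obtain ⟨n, hn⟩ := hlast
    rw [hn] at hM ⊢
    have : m + 1 ≤ n := lt_of_mul_lt_mul_left hM hN'.le
    nlinarith
  have hbelow : ∀ k, k₀ ≤ k → k < Nat.find hex → height x k < N * m + N := fun k h1 h2 =>
    not_le.1 fun h => Nat.find_min hex h2 ⟨h1, h⟩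
  generalize Nat.find hex = k₁ at *
  have hlt : k₀ < k₁ := hk₁.lt_of_ne fun h => by rw [← h] at hk₁'; omega
  obtain ⟨k, rfl⟩ : ∃ k, k₁ = k + 1 := Nat.exists_eq_succ_of_ne_zero (by omega)
  have hk := hbelow k (by omega) (by omega)
  have heq : height x (k + 1) = N * m + N := by
    refine le_antisymm ?_ hk₁'
    have := (hx k (by omega) (m + 1)).1 (by linarith)
    linarith
  refine ⟨m, k₀, k + 1, hlt, hk₁N, hmin, hk₀', habove, heq, hbelow, fun j hj hjk => ?_⟩
  induction Nat.le_of_lt_succ hjk using Nat.decreasingInduction with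
  | self => rw [height_succ] at heq; omega
  | of_succ j hjk' ih =>
    by_contra! h
    obtain ⟨n, hn⟩ := hturn j (by omega) h (ih (by omega) (by omega))
    have h1 := hbelow (j + 1) (by omega) (by omega)
    have h2 := habove (j + 1) (by omega) (by omega)
    rw [hn] at h1 h2
    have h3 : m < n := lt_of_mul_lt_mul_left h2 hN'.le
    have h4 : n < m + 1 := lt_of_mul_lt_mul_left (by linarith) hN'.le
    omega


namespace KacMoodyData

variable (K : KacMoodyData I V)

lemma refl_mem_orbit {μ ν : V} (h : ν ∈ K.orbit μ) (i : I) : K.refl i ν ∈ K.orbit μ := by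
  obtain ⟨w, hw, rfl⟩ := h
  exact ⟨K.refl i * w, mul_mem (Subgroup.subset_closure ⟨i, rfl⟩) hw, rfl⟩

lemma refl_mem_P {v : V} (hv : v ∈ K.P) (i : I) : K.refl i v ∈ K.P := by
  obtain ⟨n, hn⟩ := K.pairingInt i v hv
  rw [refl_apply, hn, Int.cast_smul_eq_zsmul]
  exact sub_mem hv (zsmul_mem (K.rootMem i) n)

lemma apply_mem_P {w : V ≃ₗ[ℝ] V} (hw : w ∈ K.weylGroup) : ∀ v ∈ K.P, w v ∈ K.P := by
  suffices h : ∀ v ∈ K.P, w v ∈ K.P ∧ w⁻¹ v ∈ K.P from fun v hv => (h v hv).1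
  induction hw using Subgroup.closure_induction with
  | mem w hw =>
    obtain ⟨i, rfl⟩ := hw
    rw [inv_eq_of_mul_eq_one_left (K.refl_mul_self i)]
    exact fun v hv => ⟨K.refl_mem_P hv i, K.refl_mem_P hv i⟩
  | one => exact fun v hv => ⟨hv, by simpa using hv⟩
  | mul w w' _ _ h h' =>
    rw [mul_inv_rev]
    exact fun v hv => ⟨(h _ (h' v hv).1).1, (h' _ (h v hv).2).2⟩
  | inv w _ h =>
    rw [inv_inv]
    exact fun v hv => (h v hv).symm

/-- The directions of a path with breakpoints in `(1/N)ℤ` lie in the orbit of `μ`, and adjacent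
directions are related as required for LS paths. -/
structure Good (μ : V) (N : ℕ) (ν : ℕ → V) : Prop where
  pos : 0 < N
  mem : ∀ k, ν k ∈ K.orbit μ
  rel : ∀ k, k + 1 < N → K.SRel (((k : ℝ) + 1) / N) (ν k) (ν (k + 1))

variable {K} {μ : V} {N : ℕ} {ν : ℕ → V} {i : I} {x : ℕ → ℤ}

lemma Good.exists_int (h : K.Good μ N ν) (hμ : μ ∈ K.P) (i : I) :
    ∃ x : ℕ → ℤ, ∀ k, K.coroot i (ν k) = x k := by
  refine ⟨_, fun k => (K.pairingInt i (ν k) ?_).choose_spec⟩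
  obtain ⟨w, hw, hk⟩ := h.mem k
  rw [hk]
  exact K.apply_mem_P hw μ hμ

lemma Good.refine (h : K.Good μ N ν) {c : ℕ} (hc : 0 < c) :
    K.Good μ (N * c) fun k => ν (k / c) := by
  refine ⟨Nat.mul_pos h.pos hc, fun k => h.mem _, fun k hk => ?_⟩
  rw [Nat.succ_div]
  split_ifs with hd
  · obtain ⟨q, hq⟩ := hd
    have hkq : (k + 1) / c = k / c + 1 := by rw [Nat.succ_div, if_pos ⟨q, hq⟩]
    rw [hq, Nat.mul_div_cancel_left q hc] at hkq
    have hqN : k / c + 1 < N := by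
      rw [← hkq]
      rw [hq, mul_comm] at hk
      exact lt_of_mul_lt_mul_right hk hc.le
    convert h.rel (k / c) hqN using 1
    have h1 : (k : ℝ) + 1 = c * ((k / c : ℕ) + 1) := by
      rw [hkq] at hq
      exact_mod_cast hq
    have hc' : (c : ℝ) ≠ 0 := by positivity
    rw [h1, Nat.cast_mul, mul_comm (N : ℝ), mul_div_mul_left _ _ hc']
  · rw [add_zero]
    exact Relation.ReflTransGen.refl

lemma exists_int_iff_dvd (hN : 0 < N) (k : ℕ) (y : ℤ) :
    (∃ n : ℤ, ((k : ℝ) + 1) / N * y = n) ↔ (N : ℤ) ∣ (k + 1) * y := by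
  have hN' : (N : ℝ) ≠ 0 := by positivity
  refine exists_congr fun n => ?_
  rw [div_mul_eq_mul_div, div_eq_iff hN', mul_comm (n : ℝ)]
  exact_mod_cast Iff.rfl

lemma Good.dvd_height_sub (h : K.Good μ N ν) (hx : ∀ k, K.coroot i (ν k) = x k) {k : ℕ}
    (hk : k < N) : (N : ℤ) ∣ height x k - k * x k := by
  induction k with
  | zero => simp [height_zero]
  | succ k ih =>
    obtain ⟨n, hn⟩ := (h.rel k hk).exists_int_sub i
    have h1 : (N : ℤ) ∣ (k + 1) * (x (k + 1) - x k) := by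
      rw [← exists_int_iff_dvd h.pos]
      refine ⟨n, ?_⟩
      rw [← hn, hx, hx]
      push_cast
      ring
    have h2 := dvd_sub (ih (by omega)) h1
    have h3 : height x (k + 1) - (k + 1 : ℕ) * x (k + 1) =
        height x k - k * x k - (k + 1) * (x (k + 1) - x k) := by
      rw [height_succ]
      push_cast
      ring
    rwa [h3]

lemma Good.exists_int_iff (h : K.Good μ N ν) (hx : ∀ k, K.coroot i (ν k) = x k) {k : ℕ}
    (hk : k < N) : (∃ n : ℤ, ((k : ℝ) + 1) / N * K.coroot i (ν k) = n) ↔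
      (N : ℤ) ∣ height x (k + 1) := by
  rw [hx, exists_int_iff_dvd h.pos]
  refine (dvd_iff_dvd_of_dvd_sub ?_).symm
  have h1 : height x (k + 1) - (k + 1) * x k = height x k - k * x k := by
    rw [height_succ]
    ring
  rw [h1]
  exact h.dvd_height_sub hx hk

lemma Good.dvd_height_last (h : K.Good μ N ν) (hx : ∀ k, K.coroot i (ν k) = x k) :
    (N : ℤ) ∣ height x N := by
  obtain ⟨k, rfl⟩ := Nat.exists_eq_succ_of_ne_zero h.pos.ne'
  rw [Nat.succ_eq_add_one, ← h.exists_int_iff hx k.lt_succ_self]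
  refine ⟨x k, ?_⟩
  have : (k : ℝ) + 1 ≠ 0 := by positivity
  rw [hx]
  push_cast
  rw [div_self this, one_mul]

/-! ### The functions `H_i` of a piecewise-linear path -/

lemma mul_H_polyPath (hN : 0 < N) (hx : ∀ k, K.coroot i (ν k) = x k) (t : ℝ) :
    N * K.H i (polyPath N ν) t = ∑ k ∈ Finset.range N, clamp01 (N * t - k) * (x k : ℝ) := by
  have hN' : (N : ℝ) ≠ 0 := by positivity
  simp only [H, polyPath, map_sum, map_smul, smul_eq_mul, hx, Finset.mul_sum]
  refine Finset.sum_congr rfl fun k _ => ?_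
  rw [← mul_assoc, mul_div_cancel₀ _ hN']

lemma mul_H_of_mem (hN : 0 < N) (hx : ∀ k, K.coroot i (ν k) = x k) {j : ℕ} (hj : j < N)
    {t : ℝ} (h0 : (j : ℝ) ≤ N * t) (h1 : N * t ≤ j + 1) :
    N * K.H i (polyPath N ν) t =
      (1 - (N * t - j)) * height x j + (N * t - j) * height x (j + 1) := by
  rw [mul_H_polyPath hN hx, sum_clamp01_mul hj _ h0 h1, height_succ, height]
  push_cast
  ring

lemma mul_H_node (hN : 0 < N) (hx : ∀ k, K.coroot i (ν k) = x k) {k : ℕ} (hk : k ≤ N) :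
    N * K.H i (polyPath N ν) (k / N) = height x k := by
  have hN' : (N : ℝ) ≠ 0 := by positivity
  have h : (N : ℝ) * (k / N) = k := mul_div_cancel₀ _ hN'
  rcases hk.lt_or_eq with hk | rfl
  · rw [mul_H_of_mem hN hx hk (by rw [h]) (by rw [h]; linarith), h]
    ring
  · obtain ⟨j, rfl⟩ := Nat.exists_eq_succ_of_ne_zero hN.ne'
    rw [mul_H_of_mem hN hx j.lt_succ_self (by rw [h]; simp) (by rw [h]; simp), h]
    push_cast
    ring

/-- Evaluation at points strictly to the left of `b / N`. -/
lemma exists_mul_H_of_lt (hN : 0 < N) (hx : ∀ k, K.coroot i (ν k) = x k) {b : ℕ} (hb : b ≤ N)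
    {t : ℝ} (h0 : 0 ≤ t) (h1 : N * t < b) : ∃ (j : ℕ) (s : ℝ), j < b ∧ 0 ≤ s ∧ s < 1 ∧
      j + s = N * t ∧
      N * K.H i (polyPath N ν) t = (1 - s) * height x j + s * height x (j + 1) := by
  have h0' : 0 ≤ N * t := by positivity
  have hj : ⌊N * t⌋₊ < b := (Nat.floor_lt h0').2 h1
  have h2 := Nat.floor_le h0'
  have h3 := Nat.lt_floor_add_one (N * t)
  exact ⟨_, N * t - ⌊N * t⌋₊, hj, by linarith, by linarith, by ring,
    mul_H_of_mem hN hx (hj.trans_le hb) h2 h3.le⟩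

/-- Evaluation at positive points to the left of `b / N`. -/
lemma exists_mul_H_of_le (hN : 0 < N) (hx : ∀ k, K.coroot i (ν k) = x k) {b : ℕ} (hb : b ≤ N)
    {t : ℝ} (h0 : 0 < t) (h1 : N * t ≤ b) : ∃ (j : ℕ) (s : ℝ), j < b ∧ 0 < s ∧ s ≤ 1 ∧
      j + s = N * t ∧
      N * K.H i (polyPath N ν) t = (1 - s) * height x j + s * height x (j + 1) := by
  have h0' : 0 < N * t := by positivity
  obtain ⟨j, hj⟩ := Nat.exists_eq_succ_of_ne_zero (Nat.ceil_pos.2 h0').ne'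
  have h2 := Nat.le_ceil (N * t)
  have h3 := Nat.ceil_lt_add_one h0'.le
  have h4 : ⌈N * t⌉₊ ≤ b := Nat.ceil_le.2 h1
  rw [hj] at h2 h3 h4
  push_cast at h2 h3
  exact ⟨j, N * t - j, by omega, by linarith, by linarith, by ring,
    mul_H_of_mem hN hx (by omega) (by linarith) (by linarith)⟩

lemma mul_H_le (hN : 0 < N) (hx : ∀ k, K.coroot i (ν k) = x k) {c : ℝ}
    (hc : ∀ k ≤ N, c ≤ height x k) {t : ℝ} (ht : t ∈ Set.Icc (0 : ℝ) 1) :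
    c ≤ N * K.H i (polyPath N ν) t := by
  rcases ht.1.eq_or_lt with rfl | h0
  · have := mul_H_node hN hx N.zero_le
    rw [Nat.cast_zero, zero_div] at this
    rw [this]
    exact hc 0 N.zero_le
  · obtain ⟨j, s, hj, hs0, hs1, -, h⟩ := exists_mul_H_of_le hN hx le_rfl h0
      (mul_le_of_le_one_right N.cast_nonneg ht.2)
    rw [h]
    nlinarith [hc j (by omega), hc (j + 1) (by omega)]

lemma H_node_eq_iff (hN : 0 < N) (hx : ∀ k, K.coroot i (ν k) = x k) {k : ℕ} (hk : k ≤ N)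
    (m : ℤ) : K.H i (polyPath N ν) (k / N) = m ↔ height x k = N * m := by
  have hN' : (N : ℝ) ≠ 0 := by positivity
  rw [← mul_right_inj' hN', mul_H_node hN hx hk]
  exact_mod_cast Iff.rfl

lemma mval_polyPath (hN : 0 < N) (hx : ∀ k, K.coroot i (ν k) = x k) {m : ℤ}
    (hm : ∀ k ≤ N, N * m ≤ height x k) {k : ℕ} (hk : k ≤ N) (hkm : height x k = N * m) :
    K.mval i (polyPath N ν) = m := by
  have hN' : (0 : ℝ) < N := by positivity
  refine IsLeast.csInf_eq ⟨⟨k / N, ⟨by positivity, ?_⟩, (H_node_eq_iff hN hx hk m).2 hkm⟩, ?_⟩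
  · exact div_le_one_of_le₀ (by exact_mod_cast hk) hN'.le
  · rintro _ ⟨t, ht, rfl⟩
    exact le_of_mul_le_mul_left (mul_H_le hN hx (fun k hk => by exact_mod_cast hm k hk) ht) hN'

lemma isLeast_min (hN : 0 < N) (hx : ∀ k, K.coroot i (ν k) = x k) {m : ℤ} {k₁ : ℕ}
    (hk₁ : k₁ ≤ N) (heq : height x k₁ = N * m) (hlt : ∀ k < k₁, N * m < height x k) :
    IsLeast {t | t ∈ Set.Icc (0 : ℝ) 1 ∧ K.H i (polyPath N ν) t = m} (k₁ / N) := by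
  have hN' : (0 : ℝ) < N := by positivity
  refine ⟨⟨⟨by positivity, div_le_one_of_le₀ (by exact_mod_cast hk₁) hN'.le⟩,
    (H_node_eq_iff hN hx hk₁ m).2 heq⟩, ?_⟩
  rintro t ⟨ht, hm⟩
  rw [div_le_iff₀' hN']
  by_contra! h
  obtain ⟨j, s, hj, hs0, hs1, -, h⟩ := exists_mul_H_of_lt hN hx hk₁ ht.1 h
  rw [hm] at h
  have h1 : (N * m : ℝ) < height x j := by exact_mod_cast hlt j hj
  have h2 : (N * m : ℝ) ≤ height x (j + 1) := by
    rcases (Nat.succ_le_of_lt hj).lt_or_eq with h' | h'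
    · exact_mod_cast (hlt (j + 1) h').le
    · rw [← Nat.succ_eq_add_one, h']
      exact_mod_cast heq.ge
  nlinarith

lemma isGreatest_before (hN : 0 < N) (hx : ∀ k, K.coroot i (ν k) = x k) {m : ℤ} {k₀ k₁ : ℕ}
    (hk : k₀ < k₁) (hk₁ : k₁ ≤ N) (heq : height x k₀ = N * m)
    (hlt : ∀ k, k₀ < k → k ≤ k₁ → height x k < N * m) :
    IsGreatest {t | t ∈ Set.Icc (0 : ℝ) (k₁ / N) ∧ K.H i (polyPath N ν) t = m} (k₀ / N) := by
  have hN' : (0 : ℝ) < N := by positivity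
  refine ⟨⟨⟨by positivity, by gcongr⟩, (H_node_eq_iff hN hx (by omega) m).2 heq⟩, ?_⟩
  rintro t ⟨ht, hm⟩
  rw [le_div_iff₀' hN']
  by_contra! h
  have h0 : 0 < t := by
    by_contra! h0
    nlinarith [(k₀.cast_nonneg : (0 : ℝ) ≤ k₀)]
  obtain ⟨j, s, hj, hs0, hs1, hjs, h'⟩ := exists_mul_H_of_le hN hx hk₁ h0
    ((le_div_iff₀' hN').1 ht.2)
  rw [hm] at h'
  have hjk : k₀ ≤ j := by
    have : (k₀ : ℝ) < (j + 1 : ℕ) := by push_cast; linarith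
    exact Nat.lt_succ_iff.1 (by exact_mod_cast this)
  have h2 : (height x (j + 1) : ℝ) < N * m := by
    exact_mod_cast hlt (j + 1) (by omega) (by omega)
  have h1 : (height x j : ℝ) ≤ N * m := by
    rcases hjk.lt_or_eq with h'' | h''
    · exact_mod_cast (hlt j h'' hj.le).le
    · rw [← h'']
      exact_mod_cast heq.le
  nlinarith

lemma isGreatest_min (hN : 0 < N) (hx : ∀ k, K.coroot i (ν k) = x k) {m : ℤ} {k₀ : ℕ}
    (hk₀ : k₀ < N) (heq : height x k₀ = N * m)
    (hlt : ∀ k, k₀ < k → k ≤ N → N * m < height x k) :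
    IsGreatest {t | t ∈ Set.Icc (0 : ℝ) 1 ∧ K.H i (polyPath N ν) t = m} (k₀ / N) := by
  have hN' : (0 : ℝ) < N := by positivity
  refine ⟨⟨⟨by positivity, div_le_one_of_le₀ (by exact_mod_cast hk₀.le) hN'.le⟩,
    (H_node_eq_iff hN hx hk₀.le m).2 heq⟩, ?_⟩
  rintro t ⟨ht, hm⟩
  rw [le_div_iff₀' hN']
  by_contra! h
  have h0 : 0 < t := by
    by_contra! h0
    nlinarith [(k₀.cast_nonneg : (0 : ℝ) ≤ k₀)]
  obtain ⟨j, s, hj, hs0, hs1, hjs, h'⟩ := exists_mul_H_of_le hN hx le_rfl h0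
    (mul_le_of_le_one_right N.cast_nonneg ht.2)
  rw [hm] at h'
  have hjk : k₀ ≤ j := by
    have : (k₀ : ℝ) < (j + 1 : ℕ) := by push_cast; linarith
    exact Nat.lt_succ_iff.1 (by exact_mod_cast this)
  have h2 : (N * m : ℝ) < height x (j + 1) := by
    exact_mod_cast hlt (j + 1) (by omega) (by omega)
  have h1 : (N * m : ℝ) ≤ height x j := by
    rcases hjk.lt_or_eq with h'' | h''
    · exact_mod_cast (hlt j h'' hj.le).le
    · rw [← h'']
      exact_mod_cast heq.ge
  nlinarith

lemma isLeast_after (hN : 0 < N) (hx : ∀ k, K.coroot i (ν k) = x k) {m : ℤ} {k₀ k₁ : ℕ}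
    (hk : k₀ < k₁) (hk₁ : k₁ ≤ N) (heq : height x k₁ = N * m)
    (hlt : ∀ k, k₀ ≤ k → k < k₁ → height x k < N * m) :
    IsLeast {t | t ∈ Set.Icc (k₀ / N : ℝ) 1 ∧ K.H i (polyPath N ν) t = m} (k₁ / N) := by
  have hN' : (0 : ℝ) < N := by positivity
  refine ⟨⟨⟨by gcongr, div_le_one_of_le₀ (by exact_mod_cast hk₁) hN'.le⟩,
    (H_node_eq_iff hN hx hk₁ m).2 heq⟩, ?_⟩
  rintro t ⟨ht, hm⟩
  have ht0 := (div_le_iff₀' hN').1 ht.1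
  rw [div_le_iff₀' hN']
  by_contra! h
  obtain ⟨j, s, hj, hs0, hs1, hjs, h⟩ :=
    exists_mul_H_of_lt hN hx hk₁ (le_trans (by positivity) ht.1) h
  rw [hm] at h
  have hjk : k₀ ≤ j := by
    have : (k₀ : ℝ) < (j + 1 : ℕ) := by push_cast; linarith
    exact Nat.lt_succ_iff.1 (by exact_mod_cast this)
  have h1 : (height x j : ℝ) < N * m := by exact_mod_cast hlt j hjk hj
  have h2 : (height x (j + 1) : ℝ) ≤ N * m := by
    rcases (Nat.succ_le_of_lt hj).lt_or_eq with h' | h'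
    · exact_mod_cast (hlt (j + 1) (by omega) h').le
    · rw [← Nat.succ_eq_add_one, h']
      exact_mod_cast heq.le
  nlinarith

/-! ### Reflecting the directions in an interval -/

/-- Reflect the directions with index in `[k₀, k₁)`. -/
def reflDir (K : KacMoodyData I V) (i : I) (k₀ k₁ : ℕ) (ν : ℕ → V) (k : ℕ) : V :=
  if k₀ ≤ k ∧ k < k₁ then K.refl i (ν k) else ν k

variable {k₀ k₁ : ℕ}

lemma reflDir_of_mem {k : ℕ} (h0 : k₀ ≤ k) (h1 : k < k₁) :
    reflDir K i k₀ k₁ ν k = K.refl i (ν k) := if_pos ⟨h0, h1⟩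

lemma reflDir_of_lt {k : ℕ} (h : k < k₀) : reflDir K i k₀ k₁ ν k = ν k := if_neg (by omega)

lemma reflDir_of_le {k : ℕ} (h : k₁ ≤ k) : reflDir K i k₀ k₁ ν k = ν k := if_neg (by omega)

lemma polyPath_reflDir_of_le (hN : 0 < N) {t : ℝ} (ht : t ≤ k₀ / N) :
    polyPath N (reflDir K i k₀ k₁ ν) t = polyPath N ν t := by
  rw [le_div_iff₀' (by positivity)] at ht
  refine Finset.sum_congr rfl fun k _ => ?_
  rcases lt_or_ge k k₀ with hk | hk
  · rw [reflDir_of_lt hk]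
  · have : (k₀ : ℝ) ≤ k := by exact_mod_cast hk
    rw [clamp01_of_nonpos (by linarith), zero_div, zero_smul, zero_smul]

lemma polyPath_reflDir_of_mem (hN : 0 < N) {t : ℝ} (h0 : k₀ / N ≤ t) (h1 : t ≤ k₁ / N) :
    polyPath N (reflDir K i k₀ k₁ ν) t =
      K.refl i (polyPath N ν t - polyPath N ν (k₀ / N)) + polyPath N ν (k₀ / N) := by
  have hN' : (0 : ℝ) < N := by positivity
  rw [le_div_iff₀' hN'] at h1
  rw [div_le_iff₀' hN'] at h0
  simp only [polyPath, ← Finset.sum_sub_distrib, map_sum, ← Finset.sum_add_distrib,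
    mul_div_cancel₀ _ hN'.ne', ← sub_smul, map_smul]
  refine Finset.sum_congr rfl fun k _ => ?_
  rcases lt_or_ge k k₀ with hk | hk
  · have : (k : ℝ) + 1 ≤ k₀ := by exact_mod_cast hk
    rw [reflDir_of_lt hk, clamp01_of_one_le (by linarith), clamp01_of_one_le (by linarith),
      sub_self, zero_smul, zero_add]
  have hk' : (k₀ : ℝ) ≤ k := by exact_mod_cast hk
  rw [clamp01_of_nonpos (by linarith : (k₀ : ℝ) - k ≤ 0), zero_div, zero_smul, sub_zero, add_zero]
  rcases lt_or_ge k k₁ with hk1 | hk1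
  · rw [reflDir_of_mem hk hk1]
  · have : (k₁ : ℝ) ≤ k := by exact_mod_cast hk1
    rw [clamp01_of_nonpos (by linarith), zero_div, zero_smul, zero_smul]

lemma polyPath_reflDir_of_ge (hN : 0 < N) (hk : k₀ ≤ k₁) {t : ℝ} (ht : k₁ / N ≤ t) :
    polyPath N (reflDir K i k₀ k₁ ν) t = polyPath N ν t -
      (K.H i (polyPath N ν) (k₁ / N) - K.H i (polyPath N ν) (k₀ / N)) • K.α i := by
  have hN' : (0 : ℝ) < N := by positivity
  have hk' : (k₀ : ℝ) ≤ k₁ := by exact_mod_cast hk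
  rw [div_le_iff₀' hN'] at ht
  simp only [H, polyPath, ← Finset.sum_sub_distrib, map_sum, mul_div_cancel₀ _ hN'.ne',
    map_smul, Finset.sum_smul, smul_eq_mul, ← sub_mul]
  refine Finset.sum_congr rfl fun k _ => ?_
  rcases lt_or_ge k k₀ with hk | hk
  · have : (k : ℝ) + 1 ≤ k₀ := by exact_mod_cast hk
    rw [reflDir_of_lt hk, clamp01_of_one_le (by linarith : 1 ≤ (k₁ : ℝ) - k),
      clamp01_of_one_le (by linarith : 1 ≤ (k₀ : ℝ) - k), sub_self, zero_mul, zero_smul, sub_zero]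
  have hk' : (k₀ : ℝ) ≤ k := by exact_mod_cast hk
  rw [clamp01_of_nonpos (by linarith : (k₀ : ℝ) - k ≤ 0), zero_div, sub_zero]
  rcases lt_or_ge k k₁ with hk1 | hk1
  · have : (k : ℝ) + 1 ≤ k₁ := by exact_mod_cast hk1
    rw [reflDir_of_mem hk hk1, refl_apply, clamp01_of_one_le (by linarith),
      clamp01_of_one_le (by linarith), smul_sub, smul_smul]
  · have : (k₁ : ℝ) ≤ k := by exact_mod_cast hk1
    rw [reflDir_of_le hk1, clamp01_of_nonpos (by linarith : (k₁ : ℝ) - k ≤ 0), zero_div, zero_mul,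
      zero_smul, sub_zero]

lemma Good.reflect (h : K.Good μ N ν) (hk : k₀ < k₁)
    (hleft : ∀ k, k + 1 = k₀ → k + 1 < N →
      K.SRel (((k : ℝ) + 1) / N) (ν k) (K.refl i (ν (k + 1))))
    (hmid : ∀ k, k₀ ≤ k → k + 1 < k₁ → k + 1 < N →
      K.SRel (((k : ℝ) + 1) / N) (K.refl i (ν k)) (K.refl i (ν (k + 1))))
    (hright : ∀ k, k₀ ≤ k → k + 1 = k₁ → k + 1 < N →
      K.SRel (((k : ℝ) + 1) / N) (K.refl i (ν k)) (ν (k + 1))) :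
    K.Good μ N (reflDir K i k₀ k₁ ν) := by
  refine ⟨h.pos, fun k => ?_, fun k hkN => ?_⟩
  · unfold reflDir
    split_ifs
    · exact K.refl_mem_orbit (h.mem k) i
    · exact h.mem k
  · rcases lt_or_ge k k₀ with h0 | h0
    · rw [reflDir_of_lt h0]
      rcases (Nat.succ_le_of_lt h0).lt_or_eq with h1 | h1
      · rw [reflDir_of_lt h1]
        exact h.rel k hkN
      · rw [reflDir_of_mem h1.ge (by omega)]
        exact hleft k h1 hkN
    rcases lt_or_ge k k₁ with h1 | h1
    · rw [reflDir_of_mem h0 h1]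
      rcases (Nat.succ_le_of_lt h1).lt_or_eq with h2 | h2
      · rw [reflDir_of_mem (by omega) h2]
        exact hmid k h0 h2 hkN
      · rw [reflDir_of_le h2.ge]
        exact hright k h0 h2 hkN
    · rw [reflDir_of_le h1, reflDir_of_le (by omega)]
      exact h.rel k hkN

lemma not_dvd_of_lt {N m y : ℤ} (hN : 0 < N) (h0 : N * m < y) (h1 : y < N * m + N) : ¬N ∣ y := by
  rintro ⟨n, rfl⟩
  have h2 : m < n := lt_of_mul_lt_mul_left h0 hN.le
  have h3 : n < m + 1 := lt_of_mul_lt_mul_left (by linarith) hN.le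
  omega

/-- A Good path may be subdivided so that its `i`-height does not cross `Nℤ` between nodes. -/
lemma Good.exists_noCross (h : K.Good μ N ν) (hμ : μ ∈ K.P) (i : I) :
    ∃ (N' : ℕ) (ν' : ℕ → V) (x : ℕ → ℤ), K.Good μ N' ν' ∧ polyPath N' ν' = polyPath N ν ∧
      (∀ k, K.coroot i (ν' k) = x k) ∧ NoCross N' x := by
  obtain ⟨x, hx⟩ := h.exists_int hμ i
  obtain ⟨c, hc, hcross⟩ := exists_noCross_refine N x
  exact ⟨_, _, _, h.refine hc, polyPath_refine N hc ν, fun k => hx _, hcross⟩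

lemma Good.exists_eop (h : K.Good μ N ν) (hμ : μ ∈ K.P) {g : ℝ → V}
    (hg : K.eop i (polyPath N ν) = some g) :
    ∃ (N' : ℕ) (ν' : ℕ → V), K.Good μ N' ν' ∧ g = polyPath N' ν' := by
  obtain ⟨N, ν, x, h, heq, hx, hcross⟩ := h.exists_noCross hμ i
  rw [← heq, eop] at hg
  split_ifs at hg with h0
  obtain rfl := Option.some.inj hg
  have hneg : ∃ k ≤ N, height x k < 0 := by
    by_contra! hge
    refine h0 ((mval_polyPath h.pos hx (m := 0) (fun k hk => ?_) N.zero_le ?_).trans Int.cast_zero)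
    · simpa using hge k hk
    · simp [height_zero]
  obtain ⟨m, k₀, k₁, hk, hk₁N, hmin, hk₁, hfirst, hk₀, hbelow, hxneg⟩ :=
    exists_raising_interval h.pos hcross
      (fun k hkN h1 h2 => (h.exists_int_iff hx (by omega)).1
        ((h.rel k hkN).exists_int_of_neg_of_nonneg (by rw [hx]; exact_mod_cast h1)
          (by rw [hx]; exact_mod_cast h2)))
      (h.dvd_height_last hx) hneg
  have hm := mval_polyPath h.pos hx hmin hk₁N hk₁
  have hN : (0 : ℤ) < N := by exact_mod_cast h.pos
  have hneg' : ∀ k, k₀ ≤ k → k < k₁ → K.coroot i (ν k) < 0 := fun k h0 h1 => by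
    rw [hx]
    exact_mod_cast hxneg k h0 h1
  have hk₀' : height x k₀ = N * (m + 1) := by linarith
  have hH₁ := (H_node_eq_iff h.pos hx hk₁N m).2 hk₁
  have hH₀ := (H_node_eq_iff h.pos hx (by omega) (m + 1)).2 hk₀'
  refine ⟨N, reflDir K i k₀ k₁ ν, h.reflect hk ?_ ?_ ?_, ?_⟩
  · intro k hk' hkN
    subst hk'
    refine (h.rel k hkN).tail (scover_refl' (hneg' _ le_rfl hk) ?_)
    rw [← (h.rel k hkN).exists_int_iff, h.exists_int_iff hx (by omega), hk₀']
    exact dvd_mul_right _ _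
  · intro k hk0 hk1 hkN
    refine (h.rel k hkN).reflect_of_neg ?_ (hneg' k hk0 (by omega))
    rw [h.exists_int_iff hx (by omega)]
    exact not_dvd_of_lt hN (hfirst _ hk1) (hbelow _ (by omega) hk1.le)
  · intro k hk0 hk1 hkN
    refine (h.rel k hkN).refl_left (hneg' k hk0 (by omega)) ?_
    have := hmin (k + 2) (by omega)
    rw [height_succ, hk1, hk₁] at this
    rw [hx, hk1]
    exact_mod_cast (by omega : 0 ≤ x k₁)
  · have ht1 := (isLeast_min h.pos hx hk₁N hk₁ hfirst).csInf_eq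
    have ht0 := (isGreatest_before h.pos hx hk hk₁N hk₀' fun k h0 h1 => by
      linarith [hbelow k h0 h1]).csSup_eq
    push_cast at ht0 hH₀
    funext t
    dsimp only [eraw]
    rw [hm, ht1, ht0]
    split_ifs with h0 h1
    · exact (polyPath_reflDir_of_le h.pos h0).symm
    · exact (polyPath_reflDir_of_mem h.pos (not_le.1 h0).le h1).symm
    · rw [polyPath_reflDir_of_ge h.pos hk.le (not_le.1 h1).le, hH₁, hH₀, sub_add_cancel_left,
        neg_one_smul, sub_neg_eq_add]

lemma Good.exists_fop (h : K.Good μ N ν) (hμ : μ ∈ K.P) {g : ℝ → V}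
    (hg : K.fop i (polyPath N ν) = some g) :
    ∃ (N' : ℕ) (ν' : ℕ → V), K.Good μ N' ν' ∧ g = polyPath N' ν' := by
  obtain ⟨N, ν, x, h, heq, hx, hcross⟩ := h.exists_noCross hμ i
  rw [← heq, fop] at hg
  split_ifs at hg with h0
  obtain rfl := Option.some.inj hg
  have hN' : (N : ℝ) ≠ 0 := by exact_mod_cast h.pos.ne'
  have hneg : ∃ k ≤ N, height x k < height x N := by
    by_contra! hge
    obtain ⟨n, hn⟩ := h.dvd_height_last hx
    have h1 := (H_node_eq_iff h.pos hx le_rfl n).2 hn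
    rw [div_self hN'] at h1
    rw [h1, mval_polyPath h.pos hx (fun k hk => hn ▸ hge k hk) le_rfl hn] at h0
    exact h0 (sub_self _)
  obtain ⟨m, k₀, k₁, hk, hk₁N, hmin, hk₀, hlast, hk₁, hbelow, hxpos⟩ :=
    exists_lowering_interval h.pos hcross
      (fun k hkN h1 h2 => (h.exists_int_iff hx (by omega)).1
        ((h.rel k hkN).exists_int_of_nonpos_of_pos (by rw [hx]; exact_mod_cast h1)
          (by rw [hx]; exact_mod_cast h2)))
      (h.dvd_height_last hx) hneg
  have hm := mval_polyPath h.pos hx hmin (by omega) hk₀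
  have hN : (0 : ℤ) < N := by exact_mod_cast h.pos
  have hpos : ∀ k, k₀ ≤ k → k < k₁ → 0 < K.coroot i (ν k) := fun k h0 h1 => by
    rw [hx]
    exact_mod_cast hxpos k h0 h1
  have hk₁' : height x k₁ = N * (m + 1) := by linarith
  have hH₀ := (H_node_eq_iff h.pos hx (by omega) m).2 hk₀
  have hH₁ := (H_node_eq_iff h.pos hx hk₁N (m + 1)).2 hk₁'
  refine ⟨N, reflDir K i k₀ k₁ ν, h.reflect hk ?_ ?_ ?_, ?_⟩
  · intro k hk' hkN
    refine (h.rel k hkN).refl_right ?_ (hpos _ hk'.ge (by omega))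
    have := hmin k (by omega)
    rw [← hk₀, ← hk', height_succ] at this
    rw [hx]
    exact_mod_cast (by omega : x k ≤ 0)
  · intro k hk0 hk1 hkN
    refine (h.rel k hkN).reflect_of_pos ?_ (hpos (k + 1) (by omega) hk1)
    rw [h.exists_int_iff hx (by omega)]
    exact not_dvd_of_lt hN (hlast _ (by omega) (by omega)) (hbelow _ (by omega) hk1)
  · intro k hk0 hk1 hkN
    refine (h.rel k hkN).head (scover_refl (hpos k hk0 (by omega)) ?_)
    rw [h.exists_int_iff hx (by omega), hk1, hk₁']
    exact dvd_mul_right _ _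
  · have ht0 := (isGreatest_min h.pos hx (by omega) hk₀ hlast).csSup_eq
    have ht1 := (isLeast_after h.pos hx hk hk₁N hk₁' fun k h0 h1 => by
      linarith [hbelow k h0 h1]).csInf_eq
    push_cast at ht1 hH₁
    funext t
    dsimp only [fraw]
    rw [hm, ht0, ht1]
    split_ifs with h0 h1
    · exact (polyPath_reflDir_of_le h.pos h0).symm
    · exact (polyPath_reflDir_of_mem h.pos (not_le.1 h0).le h1).symm
    · rw [polyPath_reflDir_of_ge h.pos hk.le (not_le.1 h1).le, hH₁, hH₀, add_sub_cancel_left,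
        one_smul]

lemma Good.exists_applyWord (h : K.Good μ N ν) (hμ : μ ∈ K.P) (word : List (I × Bool)) {g : ℝ → V}
    (hg : K.applyWord word (some (polyPath N ν)) = some g) :
    ∃ (N' : ℕ) (ν' : ℕ → V), K.Good μ N' ν' ∧ g = polyPath N' ν' := by
  induction word generalizing N ν with
  | nil => exact ⟨N, ν, h, (Option.some.inj hg).symm⟩
  | cons p rest ih =>
    have hnone : ∀ l : List (I × Bool), K.applyWord l none = none := fun l => by
      induction l with
      | nil => rfl
      | cons q l ihl => exact ihl
    rw [applyWord, Option.bind_some] at hg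
    cases hp : (if p.2 then K.eop p.1 (polyPath N ν) else K.fop p.1 (polyPath N ν)) with
    | none => rw [hp, hnone] at hg; cases hg
    | some f =>
      rw [hp] at hg
      obtain ⟨N', ν', h', rfl⟩ :
          ∃ (N' : ℕ) (ν' : ℕ → V), K.Good μ N' ν' ∧ f = polyPath N' ν' := by
        split_ifs at hp
        · exact h.exists_eop hμ hp
        · exact h.exists_fop hμ hp
      exact ih h' hg

lemma Good.sigmaMap (h : K.Good μ N ν) {c : ℕ} (hc : 0 < c) :
    ∃ w : Fin (N * c) → (V ≃ₗ[ℝ] V), (∀ j, w j ∈ K.weylGroup) ∧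
      SigmaMap (N * c) (polyPath N ν) = List.ofFn fun j => straight ((w j) μ) := by
  choose w hw hν using fun j : Fin (N * c) => (h.refine hc).mem j
  refine ⟨w, hw, ?_⟩
  rw [← polyPath_refine N hc ν, sigmaMap_polyPath (Nat.mul_pos h.pos hc)]
  simp only [hν]

lemma exists_good_straight (K : KacMoodyData I V) (μ : V) :
    ∃ ν : ℕ → V, K.Good μ 1 ν ∧ polyPath 1 ν = straight μ :=
  ⟨fun _ => μ, ⟨one_pos, fun _ => ⟨1, one_mem _, rfl⟩, fun k hk => by omega⟩, polyPath_one _⟩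

end KacMoodyData

end LSPaper

open LSPaper in
theorem statement12 {I V : Type*} [Fintype I] [DecidableEq I] [AddCommGroup V] [Module ℝ V]
    (K : KacMoodyData I V) (μ : V) (hμ : μ ∈ K.P)
    (word : List (I × Bool)) (f : ℝ → V)
    (h : K.applyWord word (some (straight μ)) = some f) :
    ∃ m : ℕ, 1 ≤ m ∧ ∀ q ≤ word.length, ∀ g : ℝ → V,
      K.applyWord (word.take q) (some (straight μ)) = some g →
      ∃ w : Fin m → (V ≃ₗ[ℝ] V), (∀ j, w j ∈ K.weylGroup) ∧
        SigmaMap m g = List.ofFn fun j => straight ((w j) μ) := by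
  obtain ⟨ν, hν, hstr⟩ := KacMoodyData.exists_good_straight K μ
  have key : ∀ q, ∃ n : ℕ, 0 < n ∧ ∀ c, 0 < c → ∀ g : ℝ → V,
      K.applyWord (word.take q) (some (straight μ)) = some g →
      ∃ w : Fin (n * c) → (V ≃ₗ[ℝ] V), (∀ j, w j ∈ K.weylGroup) ∧
        SigmaMap (n * c) g = List.ofFn fun j => straight ((w j) μ) := by
    intro q
    rw [← hstr]
    rcases hq : K.applyWord (word.take q) (some (polyPath 1 ν)) with _ | g
    · exact ⟨1, one_pos, fun c hc g hg => by cases hg⟩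
    · obtain ⟨n, ν', h', rfl⟩ := hν.exists_applyWord hμ _ hq
      refine ⟨n, h'.pos, fun c hc g hg => ?_⟩
      rw [← Option.some.inj hg]
      exact h'.sigmaMap hc
  choose n hn hkey using key
  refine ⟨∏ q ∈ Finset.range (word.length + 1), n q, Finset.prod_pos fun q _ => hn q,
    fun q hq g hg => ?_⟩
  have hq' := Finset.mem_range.2 (Nat.lt_succ_of_le hq)
  rw [← Finset.mul_prod_erase _ n hq']
  exact hkey q _ (Finset.prod_pos fun q _ => hn q) g hg
end
end

section
/- In the rank-2 hyperbolic setting with λ = Λ₁ − Λ₂: for every w ∈ W, the weight wλ is neither dominant nor antidominant; that is, it is not the case that ⟨wλ, α_i∨⟩ ≥ 0 for both i = 1, 2, nor that ⟨wλ, α_i∨⟩ ≤ 0 for both i = 1, 2. -/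
open scoped Classical
noncomputable section

namespace LSPaper.KacMoodyData

variable {V : Type*} [AddCommGroup V] [Module ℝ V]

lemma coroot_refl_s13 {I : Type*} [Fintype I] [DecidableEq I] (K : KacMoodyData I V)
    (i j : I) (v : V) :
    K.coroot j (K.refl i v) = K.coroot j v - K.coroot i v * K.a j i := by
  change K.coroot j (K.reflMap i v) = _
  simp [reflMap, K.cartanPairing]

/-- The invariant quadratic form of a rank-two datum, in the coordinates given by the coroots. -/
def rankTwoForm (K : KacMoodyData (Fin 2) V) (v : V) : ℝ :=
  -K.a 1 0 * K.coroot 0 v ^ 2 + K.a 0 1 * K.a 1 0 * (K.coroot 0 v * K.coroot 1 v)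
    - K.a 0 1 * K.coroot 1 v ^ 2

lemma rankTwoForm_refl (K : KacMoodyData (Fin 2) V) (i : Fin 2) (v : V) :
    K.rankTwoForm (K.refl i v) = K.rankTwoForm v := by
  fin_cases i <;> simp [rankTwoForm, coroot_refl_s13, K.diag] <;> ring

lemma rankTwoForm_weylGroup (K : KacMoodyData (Fin 2) V) {w : V ≃ₗ[ℝ] V}
    (hw : w ∈ K.weylGroup) (v : V) : K.rankTwoForm (w v) = K.rankTwoForm v := by
  induction hw using Subgroup.closure_induction generalizing v with
  | mem _ h => obtain ⟨i, rfl⟩ := h; exact K.rankTwoForm_refl i v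
  | one => rfl
  | mul x y _ _ hx hy => exact (hx (y v)).trans (hy v)
  | inv x _ hx => simpa using (hx (x⁻¹ v)).symm.trans (congrArg _ (x.apply_symm_apply v))

lemma rankTwoForm_nonneg (K : KacMoodyData (Fin 2) V) {v : V}
    (h : 0 ≤ K.coroot 0 v * K.coroot 1 v) : 0 ≤ K.rankTwoForm v := by
  have h01 : (K.a 0 1 : ℝ) ≤ 0 := mod_cast K.offDiag 0 1 (by decide)
  have h10 : (K.a 1 0 : ℝ) ≤ 0 := mod_cast K.offDiag 1 0 (by decide)
  have := mul_nonneg (neg_nonneg.2 h10) (sq_nonneg (K.coroot 0 v))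
  have := mul_nonneg (neg_nonneg.2 h01) (sq_nonneg (K.coroot 1 v))
  have := mul_nonneg (mul_nonneg_of_nonpos_of_nonpos h01 h10) h
  unfold rankTwoForm
  linarith

end LSPaper.KacMoodyData

open LSPaper in
theorem statement13 {V : Type*} [AddCommGroup V] [Module ℝ V]
    (K : KacMoodyData (Fin 2) V) (a₁ a₂ : ℤ) (ha₁ : 2 ≤ a₁) (ha₂ : 2 ≤ a₂)
    (h4 : 4 < a₁ * a₂) (hA : K.a = ![![2, -a₁], ![-a₂, 2]])
    (Λ : Fin 2 → V) (hΛP : ∀ j, Λ j ∈ K.P)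
    (hpair : ∀ i j, K.coroot i (Λ j) = if i = j then 1 else 0)
    (hgen : ∀ v ∈ K.P, ∃ c₁ c₂ : ℤ, v = c₁ • Λ 0 + c₂ • Λ 1)
    (hα₁ : K.α 0 = (2 : ℝ) • Λ 0 - (a₂ : ℝ) • Λ 1)
    (hα₂ : K.α 1 = (2 : ℝ) • Λ 1 - (a₁ : ℝ) • Λ 0) :
    ∀ w ∈ K.weylGroup,
      ¬ (∀ i : Fin 2, 0 ≤ K.coroot i (w (Λ 0 - Λ 1))) ∧
      ¬ (∀ i : Fin 2, K.coroot i (w (Λ 0 - Λ 1)) ≤ 0) := by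
  intro w hw
  have hneg : K.rankTwoForm (w (Λ 0 - Λ 1)) < 0 := by
    have hlt : a₂ + a₁ - a₁ * a₂ < 0 := by
      obtain h | h : 3 ≤ a₁ ∨ 3 ≤ a₂ := by
        by_contra! h
        nlinarith
      all_goals nlinarith
    have hlt' : (a₂ + a₁ - a₁ * a₂ : ℝ) < 0 := mod_cast hlt
    rw [K.rankTwoForm_weylGroup hw]
    simp [KacMoodyData.rankTwoForm, hA, hpair]
    linarith
  refine ⟨fun h => hneg.not_ge (K.rankTwoForm_nonneg (mul_nonneg (h 0) (h 1))),
    fun h => hneg.not_ge (K.rankTwoForm_nonneg (mul_nonneg_of_nonpos_of_nonpos (h 0) (h 1)))⟩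
end
end
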